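/- Let λ be a Young diagram. Then the minimal increasing tableau M_λ is a unique rectification target for ℕ×ℕ. Furthermore, an increasing tableau T of type A has M_λ as a rectification if and only if w(T) = w(M_λ). -/

import Mathlib

open Classical

noncomputable section

/-- A straight shape in a poset: a finite lower order ideal, given as a `Finset`. -/
def StraightShape {L : Type} [PartialOrder L] (lam : Finset L) : Prop :=
  ∀ a ∈ lam, ∀ b : L, b ≤ a → b ∈ lam

/-- The shape (set of boxes) of a partially defined tableau. -/
def shapeOf {L : Type} {V : Type} (T : L → Option V) : Set L := {α | T α ≠ none}

/-- `lam ⊆ nu` is a pair of straight shapes, defining the skew shape `nu / lam`. -/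
def IsSkewPair {L : Type} [PartialOrder L] (lam nu : Finset L) : Prop :=
  StraightShape lam ∧ StraightShape nu ∧ lam ⊆ nu

/-- `T` is defined on a skew shape `nu / lam`. -/
def HasSkewShape {L : Type} [PartialOrder L] (T : L → Option ℤ) : Prop :=
  ∃ lam nu : Finset L, IsSkewPair lam nu ∧ shapeOf T = (nu : Set L) \ (lam : Set L)

/-- `T` is strictly increasing along the partial order. -/
def Increasing {L : Type} [PartialOrder L] (T : L → Option ℤ) : Prop :=
  ∀ a b : L, a < b → ∀ x y : ℤ, T a = some x → T b = some y → x < y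

/-- An increasing tableau of skew shape. -/
def IncreasingSkewTableau {L : Type} [PartialOrder L] (T : L → Option ℤ) : Prop :=
  HasSkewShape T ∧ Increasing T

/-- Two boxes are neighbors if one covers the other. -/
def Neighbor {L : Type} [PartialOrder L] (a b : L) : Prop := a ⋖ b ∨ b ⋖ a

/-- The swap operation `swap_{s,s'}`. -/
def swapVal {L : Type} [PartialOrder L] {V : Type} (s s' : V) (T : L → Option V) :
    L → Option V := fun α =>
  if T α = some s ∧ ∃ β, Neighbor α β ∧ T β = some s' then some s'
  else if T α = some s' ∧ ∃ β, Neighbor α β ∧ T β = some s then some s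
  else T α

/-- Integer values extended with a dot `•`. -/
abbrev ZDot : Type := ℤ ⊕ Unit

def toDotted {L : Type} (T : L → Option ℤ) : L → Option ZDot := fun α => (T α).map Sum.inl

/-- Place a dot in every box of `C`. -/
def addDots {L : Type} (C : Finset L) (T : L → Option ZDot) : L → Option ZDot := fun α =>
  if α ∈ C then some (Sum.inr ()) else T α

/-- Restrict a dotted tableau to its integer-valued boxes. -/
def restrictInt {L : Type} (T : L → Option ZDot) : L → Option ℤ := fun α =>
  (T α).bind (Sum.elim some fun _ => none)

/-- Apply `swap_{a,•}, swap_{a+1,•}, …, swap_{a+n-1,•}` in this (increasing) order. -/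
def swapUp {L : Type} [PartialOrder L] (a : ℤ) : ℕ → (L → Option ZDot) → (L → Option ZDot)
  | 0, T => T
  | n + 1, T => swapVal (Sum.inl (a + n)) (Sum.inr ()) (swapUp a n T)

/-- Apply `swap_{b,•}, swap_{b-1,•}, …, swap_{b-n+1,•}` in this (decreasing) order. -/
def swapDown {L : Type} [PartialOrder L] (b : ℤ) : ℕ → (L → Option ZDot) → (L → Option ZDot)
  | 0, T => T
  | n + 1, T => swapVal (Sum.inl (b - n)) (Sum.inr ()) (swapDown b n T)

/-- All values of `T` lie in the interval `[a, b]`. -/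
def ValuesIn {L : Type} (T : L → Option ℤ) (a b : ℤ) : Prop :=
  ∀ (α : L) (x : ℤ), T α = some x → a ≤ x ∧ x ≤ b

/-- `T'` is obtained from `T` by a single forward jeu de taquin slide `jdt_C`,
starting from a set `C` of maximal boxes of the inner shape. -/
def IsForwardSlide {L : Type} [PartialOrder L] (T T' : L → Option ℤ) : Prop :=
  ∃ (lam nu C : Finset L) (a b : ℤ),
    IsSkewPair lam nu ∧ shapeOf T = (nu : Set L) \ (lam : Set L) ∧ ValuesIn T a b ∧
    (∀ c ∈ C, c ∈ lam ∧ ∀ d ∈ lam, ¬ c < d) ∧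
    T' = restrictInt (swapUp a (b - a + 1).toNat (addDots C (toDotted T)))

/-- `T'` is obtained from `T` by a single reverse jeu de taquin slide,
starting from a set `C` of minimal boxes of the complement of the outer shape. -/
def IsReverseSlide {L : Type} [PartialOrder L] (T T' : L → Option ℤ) : Prop :=
  ∃ (lam nu C : Finset L) (a b : ℤ),
    IsSkewPair lam nu ∧ shapeOf T = (nu : Set L) \ (lam : Set L) ∧ ValuesIn T a b ∧
    (∀ c ∈ C, c ∉ nu ∧ ∀ d : L, d ∉ nu → ¬ d < c) ∧
    T' = restrictInt (swapDown b (b - a + 1).toNat (addDots C (toDotted T)))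

/-- Jeu de taquin equivalence: a finite sequence of forward and reverse slides. -/
def JdtEquiv {L : Type} [PartialOrder L] (T T' : L → Option ℤ) : Prop :=
  Relation.ReflTransGen (fun A B => IsForwardSlide A B ∨ IsReverseSlide A B) T T'

/-- `T` is defined on a straight shape. -/
def HasStraightShape {L : Type} [PartialOrder L] (T : L → Option ℤ) : Prop :=
  ∃ lam : Finset L, StraightShape lam ∧ shapeOf T = (lam : Set L)

/-- `U` is a rectification of `T`: a straight-shape tableau obtained by forward slides. -/
def RectifiesTo {L : Type} [PartialOrder L] (T U : L → Option ℤ) : Prop :=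
  Relation.ReflTransGen IsForwardSlide T U ∧ HasStraightShape U

/-- Unique rectification target. -/
def IsURT {L : Type} [PartialOrder L] (U : L → Option ℤ) : Prop :=
  HasStraightShape U ∧ Increasing U ∧
    ∀ T : L → Option ℤ, IncreasingSkewTableau T → RectifiesTo T U →
      ∀ U' : L → Option ℤ, RectifiesTo T U' → U' = U

/-- The minimal increasing tableau of a shape `θ`: each box `α` receives the maximal
cardinality of a totally ordered subset of `θ` having `α` as its maximal element. -/
def minTab {L : Type} [PartialOrder L] (θ : Finset L) : L → Option ℤ := fun α =>
  if α ∈ θ then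
    some ((sSup {n : ℕ | ∃ s : Finset L, (s : Set L) ⊆ (θ : Set L) ∧
      (∀ a ∈ s, ∀ b ∈ s, a ≤ b ∨ b ≤ a) ∧ α ∈ s ∧ (∀ a ∈ s, a ≤ α) ∧ s.card = n} : ℕ) : ℤ)
  else none

/-- A unique rectification poset. -/
def IsURP (L : Type) [PartialOrder L] : Prop :=
  ∀ lam : Finset L, StraightShape lam → IsURT (minTab lam)

/-- The structure constant `c^ν_{λ,μ}`: the number of increasing tableaux of
shape `ν/λ` that have the minimal increasing tableau `M_μ` as a rectification. -/
def ccoef {L : Type} [PartialOrder L] (lam mu nu : Finset L) : ℕ :=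
  Set.ncard {T : L → Option ℤ | Increasing T ∧ shapeOf T = (nu : Set L) \ (lam : Set L) ∧
    RectifiesTo T (minTab mu)}

/-- The row word of a tableau on boxes in `ℕ × ℕ`: entries are read row by row
from left to right, starting with the bottom row; `rmax` and `cmax` are bounds
enclosing the shape. -/
def rowWord (T : ℕ × ℕ → Option ℤ) (rmax cmax : ℕ) : List ℤ :=
  (List.range (rmax + 1)).reverse.flatMap fun r =>
    (List.range (cmax + 1)).filterMap fun c => T (r, c)

/-- The shape of `T` is contained in the rectangle `[0, rmax] × [0, cmax]`. -/
def BoundedBy (T : ℕ × ℕ → Option ℤ) (rmax cmax : ℕ) : Prop :=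
  ∀ p : ℕ × ℕ, T p ≠ none → p.1 ≤ rmax ∧ p.2 ≤ cmax

/-- The length (number of inversions) of a finitely supported permutation of `ℤ`. -/
def heckeLen (w : Equiv.Perm ℤ) : ℕ :=
  Set.ncard {p : ℤ × ℤ | p.1 < p.2 ∧ w p.2 < w p.1}

/-- The Hecke product `u · s_i`. -/
def heckeStep (u : Equiv.Perm ℤ) (i : ℤ) : Equiv.Perm ℤ :=
  if heckeLen u < heckeLen (u * Equiv.swap i (i + 1)) then u * Equiv.swap i (i + 1) else u

/-- The Hecke permutation `w(a) = s_{a_1} · s_{a_2} · … · s_{a_k}` of a word. -/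
def heckeWord (a : List ℤ) : Equiv.Perm ℤ := a.foldl heckeStep 1

/-- The Demazure step on bijections of `ℤ`, phrased through one-line notation. -/
def demazureStep (u : Equiv.Perm ℤ) (i : ℤ) : Equiv.Perm ℤ :=
  if u i < u (i + 1) then u * Equiv.swap i (i + 1) else u

/-- The set of inversions of a bijection of `ℤ`. -/
def inversionSet (u : Equiv.Perm ℤ) : Set (ℤ × ℤ) := {p | p.1 < p.2 ∧ u p.2 < u p.1}

lemma swap_lt_swap_of_lt {i a b : ℤ} (h : a < b) (hne : ¬ (a = i ∧ b = i + 1)) :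
    Equiv.swap i (i + 1) a < Equiv.swap i (i + 1) b := by
  simp only [Equiv.swap_apply_def]
  split_ifs <;> omega

lemma inversionSet_mul_swap {u : Equiv.Perm ℤ} {i : ℤ} (h : u i < u (i + 1)) :
    inversionSet (u * Equiv.swap i (i + 1)) =
      insert (i, i + 1)
        (Prod.map (Equiv.swap i (i + 1)) (Equiv.swap i (i + 1)) '' inversionSet u) := by
  ext ⟨a, b⟩
  simp only [inversionSet, Set.mem_ofPred_eq, Set.mem_insert_iff, Set.mem_image, Prod.exists,
    Prod.map_apply, Prod.mk.injEq, Equiv.Perm.mul_apply]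
  constructor
  · rintro ⟨hab, hu⟩
    by_cases he : a = i ∧ b = i + 1
    · exact Or.inl he
    · exact Or.inr ⟨_, _, ⟨swap_lt_swap_of_lt hab he, hu⟩, by simp, by simp⟩
  · rintro (⟨rfl, rfl⟩ | ⟨c, d, ⟨hcd, hu⟩, rfl, rfl⟩)
    · simpa using h
    · refine ⟨swap_lt_swap_of_lt hcd ?_, by simpa using hu⟩
      rintro ⟨rfl, rfl⟩
      exact absurd hu h.not_gt

lemma swap_prodMap_injective (i : ℤ) :
    Function.Injective (Prod.map (Equiv.swap i (i + 1)) (Equiv.swap i (i + 1))) :=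
  (Equiv.injective _).prodMap (Equiv.injective _)

lemma finite_inversionSet_mul_swap {u : Equiv.Perm ℤ} {i : ℤ} (h : u i < u (i + 1)) :
    (inversionSet (u * Equiv.swap i (i + 1))).Finite ↔ (inversionSet u).Finite := by
  rw [inversionSet_mul_swap h, Set.finite_insert,
    Set.finite_image_iff (swap_prodMap_injective i).injOn]

lemma heckeLen_lt_mul_swap {u : Equiv.Perm ℤ} {i : ℤ} (hf : (inversionSet u).Finite)
    (h : u i < u (i + 1)) : heckeLen u < heckeLen (u * Equiv.swap i (i + 1)) := by
  change (inversionSet u).ncard < (inversionSet (u * Equiv.swap i (i + 1))).ncard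
  rw [inversionSet_mul_swap h, Set.ncard_insert_of_notMem _ (hf.image _),
    Set.ncard_image_of_injective _ (swap_prodMap_injective i)]
  · exact Nat.lt_succ_self _
  · rintro ⟨⟨c, d⟩, ⟨hcd, -⟩, he⟩
    simp only [Prod.map_apply, Prod.mk.injEq, Equiv.swap_apply_eq_iff, Equiv.swap_apply_left,
      Equiv.swap_apply_right] at he
    simp only [he.1, he.2] at hcd
    omega

lemma heckeStep_eq_demazureStep {u : Equiv.Perm ℤ} (hf : (inversionSet u).Finite) (i : ℤ) :
    heckeStep u i = demazureStep u i := by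
  unfold heckeStep demazureStep
  by_cases h : u i < u (i + 1)
  · rw [if_pos h, if_pos (heckeLen_lt_mul_swap hf h)]
  · rw [if_neg h, if_neg]
    have hlt : (u * Equiv.swap i (i + 1)) i < (u * Equiv.swap i (i + 1)) (i + 1) := by
      have hne : u i ≠ u (i + 1) := fun he => by simpa using u.injective he
      simp only [Equiv.Perm.mul_apply, Equiv.swap_apply_left, Equiv.swap_apply_right]
      omega
    have hu : u * Equiv.swap i (i + 1) * Equiv.swap i (i + 1) = u := by simp [mul_assoc]
    have h1 := finite_inversionSet_mul_swap hlt
    rw [hu] at h1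
    have h2 := heckeLen_lt_mul_swap (h1.1 hf) hlt
    rw [hu] at h2
    exact h2.not_gt

lemma finite_inversionSet_demazureStep {u : Equiv.Perm ℤ} (hf : (inversionSet u).Finite) (i : ℤ) :
    (inversionSet (demazureStep u i)).Finite := by
  unfold demazureStep
  split_ifs with h
  · exact (finite_inversionSet_mul_swap h).2 hf
  · exact hf

lemma foldl_heckeStep (a : List ℤ) {u : Equiv.Perm ℤ} (hf : (inversionSet u).Finite) :
    a.foldl heckeStep u = a.foldl demazureStep u := by
  induction a generalizing u with
  | nil => rfl
  | cons i a ih =>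
    rw [List.foldl_cons, List.foldl_cons, heckeStep_eq_demazureStep hf,
      ih (finite_inversionSet_demazureStep hf i)]

lemma heckeWord_eq (a : List ℤ) : heckeWord a = a.foldl demazureStep 1 := by
  refine foldl_heckeStep a ?_
  convert Set.finite_empty (α := ℤ × ℤ)
  ext ⟨x, y⟩
  simp only [inversionSet, Set.mem_ofPred_eq, Equiv.Perm.one_apply, Set.mem_empty_iff_false,
    iff_false, not_and, not_lt]
  exact le_of_lt

lemma demazureStep_idem (u : Equiv.Perm ℤ) (i : ℤ) :
    demazureStep (demazureStep u i) i = demazureStep u i := by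
  unfold demazureStep
  split_ifs with h1 h2
  · simp only [Equiv.Perm.mul_apply, Equiv.swap_apply_left, Equiv.swap_apply_right] at h2
    omega
  all_goals rfl

lemma swap_succ_comm {i j : ℤ} (h : i + 2 ≤ j) :
    Equiv.swap i (i + 1) * Equiv.swap j (j + 1) = Equiv.swap j (j + 1) * Equiv.swap i (i + 1) := by
  ext x
  simp only [Equiv.Perm.mul_apply, Equiv.swap_apply_def]
  split_ifs <;> omega

lemma demazureStep_comm (u : Equiv.Perm ℤ) {i j : ℤ} (h : i + 2 ≤ j) :
    demazureStep (demazureStep u i) j = demazureStep (demazureStep u j) i := by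
  have e1 : Equiv.swap i (i + 1) j = j := Equiv.swap_apply_of_ne_of_ne (by omega) (by omega)
  have e2 : Equiv.swap i (i + 1) (j + 1) = j + 1 :=
    Equiv.swap_apply_of_ne_of_ne (by omega) (by omega)
  have e3 : Equiv.swap j (j + 1) i = i := Equiv.swap_apply_of_ne_of_ne (by omega) (by omega)
  have e4 : Equiv.swap j (j + 1) (i + 1) = i + 1 :=
    Equiv.swap_apply_of_ne_of_ne (by omega) (by omega)
  unfold demazureStep
  by_cases h1 : u i < u (i + 1) <;> by_cases h2 : u j < u (j + 1) <;>
    simp [h1, h2, e1, e2, e3, e4, mul_assoc, swap_succ_comm h]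

lemma swap_succ_braid (i : ℤ) :
    Equiv.swap i (i + 1) * (Equiv.swap (i + 1) (i + 1 + 1) * Equiv.swap i (i + 1)) =
      Equiv.swap (i + 1) (i + 1 + 1) * (Equiv.swap i (i + 1) * Equiv.swap (i + 1) (i + 1 + 1)) := by
  ext x
  simp only [Equiv.Perm.mul_apply, Equiv.swap_apply_def]
  split_ifs <;> omega

lemma demazureStep_braid (u : Equiv.Perm ℤ) (i : ℤ) :
    demazureStep (demazureStep (demazureStep u i) (i + 1)) i =
      demazureStep (demazureStep (demazureStep u (i + 1)) i) (i + 1) := by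
  have e1 : Equiv.swap i (i + 1) (i + 1 + 1) = i + 1 + 1 :=
    Equiv.swap_apply_of_ne_of_ne (by omega) (by omega)
  have e2 : Equiv.swap (i + 1) (i + 1 + 1) i = i :=
    Equiv.swap_apply_of_ne_of_ne (by omega) (by omega)
  unfold demazureStep
  rcases lt_or_ge (u i) (u (i + 1)) with h1 | h1 <;>
  rcases lt_or_ge (u (i + 1)) (u (i + 1 + 1)) with h2 | h2 <;>
  rcases lt_or_ge (u i) (u (i + 1 + 1)) with h3 | h3 <;>
  first
  | omega
  | simp [h1, h2, h3, h1.not_gt, h2.not_gt, h3.not_gt, e1, e2, mul_assoc, swap_succ_braid]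

/-- The Demazure step as an element of a monoid; products act from left to right. -/
def demazureGen (i : ℤ) : (Function.End (Equiv.Perm ℤ))ᵐᵒᵖ :=
  MulOpposite.op fun u => demazureStep u i

lemma unop_prod_demazureGen (a : List ℤ) (u : Equiv.Perm ℤ) :
    (a.map demazureGen).prod.unop u = a.foldl demazureStep u := by
  induction a generalizing u with
  | nil => rfl
  | cons i a ih =>
    rw [List.foldl_cons, ← ih]
    rfl

/-- The defining relations of the `0`-Hecke monoid with generators indexed by `ℤ`. -/
structure IsZeroHecke {M : Type} [Monoid M] (σ : ℤ → M) : Prop where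
  idem : ∀ i, σ i * σ i = σ i
  comm : ∀ i j, i + 2 ≤ j → Commute (σ i) (σ j)
  braid : ∀ i, σ i * σ (i + 1) * σ i = σ (i + 1) * σ i * σ (i + 1)

lemma isZeroHecke_demazureGen : IsZeroHecke demazureGen where
  idem _ := MulOpposite.unop_injective (funext fun u => demazureStep_idem u _)
  comm _ _ h := MulOpposite.unop_injective (funext fun u => demazureStep_comm u h)
  braid _ := MulOpposite.unop_injective (funext fun u => demazureStep_braid u _)

section RowProducts

variable {M : Type} [Monoid M] (σ : ℤ → M)

/-- The generator `σ x` if `x` satisfies `p`, and `1` otherwise. -/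
def rowLetter (p : ℤ → Prop) (x : ℤ) : M := if p x then σ x else 1

/-- The increasing product of the generators `σ y` with `p y` over `a ≤ y < a + n`,
built by appending factors on the right. -/
def rowProdLeft (p : ℤ → Prop) (a : ℤ) : ℕ → M
  | 0 => 1
  | n + 1 => rowProdLeft p a n * rowLetter σ p (a + n)

/-- The increasing product of the generators `σ y` with `p y` over `x ≤ y < x + m`,
built by appending factors on the left. -/
def rowProdRight (p : ℤ → Prop) (x : ℤ) : ℕ → M
  | 0 => 1
  | m + 1 => rowLetter σ p x * rowProdRight p (x + 1) m

/-- The last nontrivial factor of `rowProdLeft`. -/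
def rowCarry (p : ℤ → Prop) (a : ℤ) : ℕ → M
  | 0 => 1
  | n + 1 => if p (a + n) then σ (a + n) else rowCarry p a n

variable {σ}

lemma rowProdLeft_mul_rowProdRight (p : ℤ → Prop) (a : ℤ) (n m : ℕ) :
    rowProdLeft σ p a n * rowProdRight σ p (a + n) m = rowProdLeft σ p a (n + m) := by
  induction m generalizing n with
  | zero => simp [rowProdRight]
  | succ m ih =>
    have h := ih (n + 1)
    rw [rowProdLeft, mul_assoc] at h
    rw [rowProdRight, show n + (m + 1) = n + 1 + m by ring, ← h]
    push_cast
    rw [add_assoc]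

lemma rowProdRight_eq_rowProdLeft (p : ℤ → Prop) (a : ℤ) (m : ℕ) :
    rowProdRight σ p a m = rowProdLeft σ p a m := by
  simpa [rowProdLeft] using rowProdLeft_mul_rowProdRight (σ := σ) p a 0 m

lemma rowProdLeft_commute {a : ℤ} {n : ℕ} {p : ℤ → Prop} {z : M}
    (h : ∀ y, y < a + n → Commute (σ y) z) : Commute (rowProdLeft σ p a n) z := by
  induction n with
  | zero => exact Commute.one_left _
  | succ n ih =>
    refine Commute.mul_left (ih fun y hy => h y (by push_cast; omega)) ?_
    unfold rowLetter
    split_ifs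
    · exact h _ (by push_cast; omega)
    · exact Commute.one_left _

lemma rowCarry_commute {a : ℤ} {n : ℕ} {p : ℤ → Prop} {z : M}
    (h : ∀ y, y < a + n → Commute (σ y) z) : Commute (rowCarry σ p a n) z := by
  induction n with
  | zero => exact Commute.one_left _
  | succ n ih =>
    unfold rowCarry
    split_ifs
    · exact h _ (by push_cast; omega)
    · exact ih fun y hy => h y (by push_cast; omega)

lemma commute_rowProdRight (hσ : IsZeroHecke σ) {y x : ℤ} (h : y + 2 ≤ x) (p : ℤ → Prop) (m : ℕ) :
    Commute (σ y) (rowProdRight σ p x m) := by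
  induction m generalizing x with
  | zero => exact Commute.one_right _
  | succ m ih =>
    refine Commute.mul_right ?_ (ih (by omega))
    unfold rowLetter
    split_ifs
    · exact hσ.comm _ _ h
    · exact Commute.one_right _

lemma commute_rowProdRight_of_not (hσ : IsZeroHecke σ) {x : ℤ} {p : ℤ → Prop}
    (h : ¬ p (x + 1)) (m : ℕ) :
    Commute (σ x) (rowProdRight σ p (x + 1) m) := by
  cases m with
  | zero => exact Commute.one_right _
  | succ m =>
    rw [rowProdRight, rowLetter, if_neg h, one_mul]
    exact commute_rowProdRight hσ (by omega) p m

lemma rowProdLeft_commute_of_not (hσ : IsZeroHecke σ) {a : ℤ} {n : ℕ} {p : ℤ → Prop}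
    (h : ¬ p (a + n - 1)) :
    Commute (rowProdLeft σ p a n) (σ (a + n)) := by
  cases n with
  | zero => exact Commute.one_left _
  | succ n =>
    have h' : ¬ p (a + n) := by
      convert h using 2
      push_cast
      ring
    rw [rowProdLeft, rowLetter, if_neg h', mul_one]
    exact rowProdLeft_commute fun y hy => hσ.comm _ _ (by push_cast; omega)

lemma rowProdLeft_mul_rowCarry (hσ : IsZeroHecke σ) (p : ℤ → Prop) (a : ℤ) (n : ℕ) :
    rowProdLeft σ p a n * rowCarry σ p a n = rowProdLeft σ p a n := by
  induction n with
  | zero => exact one_mul 1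
  | succ n ih =>
    unfold rowProdLeft rowCarry rowLetter
    split_ifs
    · rw [mul_assoc, hσ.idem]
    · rw [mul_one, ih]

lemma rowProdLeft_mul_gen_mul_rowCarry (hσ : IsZeroHecke σ) (p : ℤ → Prop) (a : ℤ) (n : ℕ) :
    rowProdLeft σ p a n * σ (a + n) * rowCarry σ p a n =
      σ (a + n) * rowProdLeft σ p a n * σ (a + n) := by
  cases n with
  | zero => simp [rowProdLeft, rowCarry, hσ.idem]
  | succ n =>
    have hL : Commute (rowProdLeft σ p a n) (σ (a + (n + 1 : ℕ))) :=
      rowProdLeft_commute fun y hy => hσ.comm _ _ (by push_cast; omega)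
    have hK : Commute (rowCarry σ p a n) (σ (a + (n + 1 : ℕ))) :=
      rowCarry_commute fun y hy => hσ.comm _ _ (by push_cast; omega)
    unfold rowProdLeft rowCarry rowLetter
    split_ifs with h
    · have hb := hσ.braid (a + n)
      rw [show a + (n : ℤ) + 1 = a + (n + 1 : ℕ) by push_cast; ring] at hb
      rw [← mul_assoc (σ _) (rowProdLeft σ p a n), ← hL.eq]
      simp only [mul_assoc] at hb ⊢
      rw [hb]
    · rw [mul_one, mul_assoc, ← hK.eq, ← mul_assoc, rowProdLeft_mul_rowCarry hσ, ← hL.eq,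
        mul_assoc, hσ.idem]

end RowProducts

/-- The possible changes of two adjacent rows when the value `x` is swapped with the dots.
Here `q` and `p` are the old contents of the lower and upper row, `q'` and `p'` the new ones,
and `A`, `A'` record whether the two rows carry diagonally adjacent dots before and after. -/
def RowTransition (q q' p p' : ℤ → Prop) (A A' : Prop) (x : ℤ) : Prop :=
  (¬ A ∧ ¬ A' ∧ (q x ↔ q' x) ∧ (p x ↔ p' x)) ∨
  (¬ A ∧ ¬ A' ∧ q x ∧ ¬ q' x ∧ ¬ p x ∧ p' x ∧ ¬ p' (x - 1) ∧ ¬ q (x + 1)) ∨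
  (¬ A ∧ A' ∧ (q x ↔ q' x) ∧ ¬ p x ∧ ¬ p' x) ∨
  (¬ A ∧ A' ∧ q x ∧ ¬ q' x ∧ p x ∧ p' x ∧ ¬ p' (x - 1)) ∨
  (A ∧ A' ∧ ¬ q x ∧ ¬ q' x ∧ ¬ p x ∧ ¬ p' x) ∨
  (A ∧ A' ∧ q x ∧ q' x ∧ p x ∧ p' x) ∨
  (A ∧ ¬ A' ∧ ¬ q x ∧ ¬ q' x ∧ (p x ↔ p' x)) ∨
  (A ∧ ¬ A' ∧ q x ∧ q' x ∧ ¬ p x ∧ p' x ∧ ¬ q (x + 1))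

section TwoRows

variable {M : Type} [Monoid M] {σ : ℤ → M}

/-- The Hecke product of two adjacent rows in which the values below `a + n` have already
been swapped with the dots. -/
def mixedProd (σ : ℤ → M) (q q' p p' : ℤ → Prop) (A : Prop) (a : ℤ) (n m : ℕ) : M :=
  if A then rowProdLeft σ q' a n * rowProdLeft σ p' a n * rowProdRight σ q (a + n) m *
    rowCarry σ p' a n * rowProdRight σ p (a + n) m
  else rowProdLeft σ q' a n * rowProdRight σ q (a + n) m * rowProdLeft σ p' a n *
    rowProdRight σ p (a + n) m

lemma mixedProd_succ (hσ : IsZeroHecke σ) {q q' p p' : ℤ → Prop} {A A' : Prop} {a : ℤ} {n : ℕ}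
    (h : RowTransition q q' p p' A A' (a + n)) (m : ℕ) :
    mixedProd σ q q' p p' A a n (m + 1) = mixedProd σ q q' p p' A' a (n + 1) m := by
  have hx : a + ((n + 1 : ℕ) : ℤ) = a + n + 1 := by push_cast; ring
  have hcp : Commute (rowProdLeft σ p' a n) (rowProdRight σ q (a + n + 1) m) :=
    rowProdLeft_commute fun y hy => commute_rowProdRight hσ (by omega) _ _
  have hck : Commute (rowCarry σ p' a n) (rowProdRight σ q (a + n + 1) m) :=
    rowCarry_commute fun y hy => commute_rowProdRight hσ (by omega) _ _
  have hpk := rowProdLeft_mul_rowCarry hσ p' a n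
  have hK := rowProdLeft_mul_gen_mul_rowCarry hσ p' a n
  have hcq : ¬ q (a + n + 1) → Commute (σ (a + n)) (rowProdRight σ q (a + n + 1) m) :=
    fun hq => commute_rowProdRight_of_not hσ hq m
  have hcs : ¬ p' (a + n - 1) → Commute (rowProdLeft σ p' a n) (σ (a + n)) :=
    rowProdLeft_commute_of_not hσ
  have hs := hσ.idem (a + n)
  unfold mixedProd
  rw [hx]
  simp only [rowProdLeft, rowProdRight, rowLetter, rowCarry]
  generalize rowProdLeft σ q' a n = X at *
  generalize rowProdLeft σ p' a n = L at *
  generalize rowProdRight σ q (a + n + 1) m = H at *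
  generalize rowProdRight σ p (a + n + 1) m = Y at *
  generalize rowCarry σ p' a n = k at *
  have hkH : ∀ Z, H * (k * Z) = k * (H * Z) := fun Z => by rw [← mul_assoc, ← hck.eq, mul_assoc]
  have hHL : ∀ Z, H * (L * Z) = L * (H * Z) := fun Z => by rw [← mul_assoc, ← hcp.eq, mul_assoc]
  have hLk : ∀ Z, L * (k * Z) = L * Z := fun Z => by rw [← mul_assoc, hpk]
  have hLsk : ∀ Z, L * (σ (a + n) * (k * Z)) = σ (a + n) * (L * (σ (a + n) * Z)) := fun Z => by
    simpa only [mul_assoc] using congrArg (· * Z) hK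
  rcases h with ⟨hA, hA', h1, h2⟩ | ⟨hA, hA', h1, h2, h3, h4, h5, h6⟩ | ⟨hA, hA', h1, h2, h3⟩ |
    ⟨hA, hA', h1, h2, h3, h4, h5⟩ | ⟨hA, hA', h1, h2, h3, h4⟩ | ⟨hA, hA', h1, h2, h3, h4⟩ |
    ⟨hA, hA', h1, h2, h3⟩ | ⟨hA, hA', h1, h2, h3, h4, h5⟩
  · simp only [hA, hA', h1, h2, if_false]
    by_cases e1 : q' (a + n) <;> by_cases e2 : p' (a + n) <;> simp [e1, e2, mul_assoc]
  · simp only [hA, hA', h1, h2, h3, h4, if_false, if_true, one_mul, mul_one, mul_assoc, hHL]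
    rw [← mul_assoc H, ← (hcq h6).eq, mul_assoc, ← mul_assoc L (σ _), (hcs h5).eq, mul_assoc]
  · simp only [hA, hA', h1, h2, h3, if_false, if_true, one_mul, mul_one, mul_assoc, hkH, hHL, hLk]
  · simp only [hA, hA', h1, h2, h3, h4, if_false, if_true, one_mul, mul_assoc, hHL]
    rw [← mul_assoc L (σ _), (hcs h5).eq, mul_assoc]
  · simp [hA, hA', h1, h2, h3, h4]
  · simp only [hA, hA', h1, h2, h3, h4, if_true, mul_assoc, hkH, hLsk]
  · simp only [hA, hA', h1, h2, h3, if_false, if_true, one_mul, mul_one, mul_assoc, hkH, hHL, hLk]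
  · simp only [hA, hA', h1, h2, h3, h4, if_false, if_true, one_mul, mul_assoc, hkH, hHL, hLsk]
    rw [← mul_assoc H, ← (hcq h5).eq, mul_assoc]

/-- Two adjacent rows have the same Hecke product before and after a slide. -/
theorem rowProd_mul_rowProd_eq (hσ : IsZeroHecke σ) {q q' p p' : ℤ → Prop} {a : ℤ} {N : ℕ}
    (A : ℕ → Prop) (h : ∀ n < N, RowTransition q q' p p' (A n) (A (n + 1)) (a + n)) :
    rowProdLeft σ q a N * rowProdLeft σ p a N = rowProdLeft σ q' a N * rowProdLeft σ p' a N := by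
  have key : ∀ n ≤ N, mixedProd σ q q' p p' (A 0) a 0 N =
      mixedProd σ q q' p p' (A n) a n (N - n) := by
    intro n hn
    induction n with
    | zero => rfl
    | succ n ih =>
      rw [ih (by omega), ← mixedProd_succ hσ (h n hn), show N - n = N - (n + 1) + 1 by omega]
  have hk := key N le_rfl
  rw [Nat.sub_self] at hk
  unfold mixedProd at hk
  simpa [rowProdLeft, rowProdRight, rowCarry, rowProdRight_eq_rowProdLeft, mul_assoc,
    rowProdLeft_mul_rowCarry hσ] using hk

end TwoRows

/-- A predicate with at most one witness is empty or a singleton. -/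
lemma eq_false_or_eq_singleton {α : Type} {P : α → Prop} (h : ∀ c d, P c → P d → c = d) :
    (P = fun _ => False) ∨ ∃ e, P = fun c => c = e := by
  by_cases h' : ∃ e, P e
  · obtain ⟨e, he⟩ := h'
    exact Or.inr ⟨e, funext fun c => propext ⟨fun hc => h c e hc he, fun hc => hc ▸ he⟩⟩
  · exact Or.inl (funext fun c => propext ⟨fun hc => h' ⟨c, hc⟩, False.elim⟩)

/-- The transition rule for two adjacent rows, stated for abstract positions: `B`, `X` are the
positions of the dot and of the value `x` in the upper (`t`) and lower (`b`) row, `At` the columns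
with a dot just above the upper row, `Ub` the columns with an `x` just below the lower row,
`Tt` the positions of `x - 1` in the upper row and `Sb` those of `x + 1` in the lower row. -/
lemma rowTransition_of_positions {Bt Xt At Tt Bb Xb Ub Sb : ℕ → Prop}
    {Bt' Xt' Bb' Xb' : ℕ → Prop}
    (hXt' : ∀ c, Xt' c ↔ (Xt c ∧ ¬ (∃ k, c = k + 1 ∧ Bt k) ∧ ¬ At c) ∨ (Bt c ∧ (Xt (c + 1) ∨ Xb c)))
    (hBt' : ∀ c, Bt' c ↔ (Xt c ∧ ((∃ k, c = k + 1 ∧ Bt k) ∨ At c)) ∨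
      (Bt c ∧ ¬ Xt (c + 1) ∧ ¬ Xb c))
    (hXb' : ∀ c, Xb' c ↔ (Xb c ∧ ¬ (∃ k, c = k + 1 ∧ Bb k) ∧ ¬ Bt c) ∨ (Bb c ∧ (Xb (c + 1) ∨ Ub c)))
    (hBb' : ∀ c, Bb' c ↔ (Xb c ∧ ((∃ k, c = k + 1 ∧ Bb k) ∨ Bt c)) ∨
      (Bb c ∧ ¬ Xb (c + 1) ∧ ¬ Ub c))
    (hBBt : ∀ c d, Bt c → Bt d → c = d) (hBBb : ∀ c d, Bb c → Bb d → c = d)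
    (hXXt : ∀ c d, Xt c → Xt d → c = d) (hXXb : ∀ c d, Xb c → Xb d → c = d)
    (hBXt : ∀ c d, Bt c → Xt d → d = c + 1) (hBXb : ∀ c d, Bb c → Xb d → d = c + 1)
    (hBB : ∀ c d, Bt c → Bb d → d < c) (hBX : ∀ c d, Bt c → Xb d → d ≤ c)
    (hXB : ∀ c d, Xt c → Bb d → d < c) (hXX : ∀ c d, Xt c → Xb d → d < c)
    (hTB : ∀ c d, Tt c → Bt d → d = c + 1)
    (hT : ∀ c, Tt c → Bt (c + 1) → Xb (c + 1) → Bb c)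
    (hS : ∀ c, Bt c → Sb (c + 1) → Xt (c + 1))
    (hXS : ∀ c d, Xb c → Sb d → d = c + 1)
    {q q' p p' : ℤ → Prop} {x : ℤ}
    (hq : q x ↔ ∃ c, Xb c) (hq' : q' x ↔ (∃ c, Xb c) ∧ ∃ c, Xb' c)
    (hp : p x ↔ (∃ c, Xt c) ∧ ∃ c, Xt' c) (hp' : p' x ↔ ∃ c, Xt' c)
    (hpt : p' (x - 1) → ∃ c, Tt c) (hqs : q (x + 1) → ∃ c, Sb c) :
    RowTransition q q' p p' (∃ c, Bt (c + 1) ∧ Bb c) (∃ c, Bt' (c + 1) ∧ Bb' c) x := by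
  obtain rfl := funext fun c => propext (hXt' c)
  obtain rfl := funext fun c => propext (hBt' c)
  obtain rfl := funext fun c => propext (hXb' c)
  obtain rfl := funext fun c => propext (hBb' c)
  clear hXt' hBt' hXb' hBb'
  unfold RowTransition
  rcases eq_false_or_eq_singleton hBBt with rfl | ⟨b, rfl⟩ <;>
  rcases eq_false_or_eq_singleton hBBb with rfl | ⟨f, rfl⟩ <;>
  rcases eq_false_or_eq_singleton hXXt with rfl | ⟨e, rfl⟩ <;>
  rcases eq_false_or_eq_singleton hXXb with rfl | ⟨d, rfl⟩ <;>
  clear hBBt hBBb hXXt hXXb <;>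
  simp only [false_and, and_false, or_false, false_or, exists_false, not_false_eq_true, and_true, true_and,
      exists_eq_left, exists_eq_right, exists_eq, forall_eq, false_implies, implies_true, iff_false,
      exists_or] at *
  all_goals grind

/-- The position of a dotted value in the total order where the dot lies just above `t`. -/
def dotKey (t : ℤ) : ZDot → ℤ := Sum.elim (fun y => 2 * y) fun _ => 2 * t + 1

@[simp] lemma dotKey_inl (t y : ℤ) : dotKey t (Sum.inl y) = 2 * y := rfl

@[simp] lemma dotKey_inr (t : ℤ) (u : Unit) : dotKey t (Sum.inr u) = 2 * t + 1 := rfl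

/-- A dotted tableau on a convex shape which is increasing when the dot is placed just
above `t`. -/
structure DotIncreasing {L : Type} [PartialOrder L] (t : ℤ) (D : L → Option ZDot) : Prop where
  key_lt : ∀ {α β : L} {y z : ZDot}, α < β → D α = some y → D β = some z →
    dotKey t y < dotKey t z
  convex : ∀ {α β γ : L} {y z : ZDot}, α ≤ β → β ≤ γ → D α = some y → D γ = some z →
    ∃ w, D β = some w

section Swap

variable {L : Type} [PartialOrder L]

lemma swapVal_some {V : Type} {s s' v : V} {D : L → Option V} {α : L} (h : D α = some v) :
    (v = s ∧ (∃ β, Neighbor α β ∧ D β = some s') ∧ swapVal s s' D α = some s') ∨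
    (v = s' ∧ (∃ β, Neighbor α β ∧ D β = some s) ∧ swapVal s s' D α = some s) ∨
    swapVal s s' D α = some v := by
  unfold swapVal
  rw [h]
  simp only [Option.some.injEq]
  split_ifs with h1 h2
  · exact Or.inl ⟨h1.1, h1.2, rfl⟩
  · exact Or.inr (Or.inl ⟨h2.1, h2.2, rfl⟩)
  · exact Or.inr (Or.inr rfl)

lemma swapVal_none {V : Type} {s s' : V} {D : L → Option V} {α : L} (h : D α = none) :
    swapVal s s' D α = none := by
  simp [swapVal, h]

lemma swapVal_eq_none_iff {V : Type} {s s' : V} {D : L → Option V} {α : L} :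
    swapVal s s' D α = none ↔ D α = none := by
  refine ⟨fun h => ?_, swapVal_none⟩
  cases hD : D α with
  | none => rfl
  | some v => rcases swapVal_some (s := s) (s' := s') hD with h' | h' | h' <;> simp_all

lemma swapVal_eq_some_iff {V : Type} {s s' v : V} {D : L → Option V} {α : L}
    (h : v ≠ s) (h' : v ≠ s') : swapVal s s' D α = some v ↔ D α = some v := by
  unfold swapVal
  split_ifs with h1 h2
  · simp [h1.1, h.symm, h'.symm]
  · simp [h2.1, h.symm, h'.symm]
  · rfl

lemma DotIncreasing.exists_between {t : ℤ} {D : L → Option ZDot} (hD : DotIncreasing t D)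
    {α β γ : L} {y z : ZDot} (h1 : α < β) (h2 : β < γ) (hα : D α = some y) (hγ : D γ = some z) :
    ∃ w, D β = some w ∧ dotKey t y < dotKey t w ∧ dotKey t w < dotKey t z := by
  obtain ⟨w, hw⟩ := hD.convex h1.le h2.le hα hγ
  exact ⟨w, hw, hD.key_lt h1 hα hw, hD.key_lt h2 hw hγ⟩

lemma DotIncreasing.swapVal {t : ℤ} {D : L → Option ZDot} (hD : DotIncreasing t D) :
    DotIncreasing (t + 1) (swapVal (Sum.inl (t + 1)) (Sum.inr ()) D) where
  key_lt := by
    intro α β y z hlt hy hz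
    cases hα : D α with
    | none => simp [swapVal_none hα] at hy
    | some u =>
    cases hβ : D β with
    | none => simp [swapVal_none hβ] at hz
    | some v =>
    have hk := hD.key_lt hlt hα hβ
    have hswap : u = Sum.inr () → v = Sum.inl (t + 1) → y = Sum.inl (t + 1) ∧ z = Sum.inr () := by
      rintro rfl rfl
      have hcov : α ⋖ β := ⟨hlt, fun γ h1 h2 => by
        obtain ⟨w, -, hw1, hw2⟩ := hD.exists_between h1 h2 hα hβ
        rcases w with w | w <;> simp at hw1 hw2
        omega⟩
      have h1 : ∃ γ, Neighbor α γ ∧ D γ = some (Sum.inl (t + 1)) := ⟨β, Or.inl hcov, hβ⟩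
      have h2 : ∃ γ, Neighbor β γ ∧ D γ = some (Sum.inr ()) := ⟨α, Or.inr hcov, hα⟩
      unfold _root_.swapVal at hy hz
      simp [hα, hβ, h1, h2] at hy hz
      exact ⟨hy.symm, hz.symm⟩
    rcases swapVal_some (s := Sum.inl (t + 1)) (s' := Sum.inr ()) hα with
        ⟨e1, -, e2⟩ | ⟨e1, -, e2⟩ | e2 <;>
      rcases swapVal_some (s := Sum.inl (t + 1)) (s' := Sum.inr ()) hβ with
        ⟨e3, -, e4⟩ | ⟨e3, -, e4⟩ | e4 <;>
      rw [hy] at e2 <;> rw [hz] at e4 <;> rw [Option.some.injEq] at e2 e4 <;>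
      rcases u with u | ⟨⟩ <;> rcases v with v | ⟨⟩ <;> rcases y with y | ⟨⟩ <;>
      rcases z with z | ⟨⟩ <;> simp at * <;> grind
  convex := by
    intro α β γ y z h1 h2 hα hγ
    rw [← Option.isSome_iff_exists, Option.isSome_iff_ne_none, ne_eq, swapVal_eq_none_iff]
    have h3 : D α ≠ none := by rw [ne_eq, ← swapVal_eq_none_iff, hα]; simp
    have h4 : D γ ≠ none := by rw [ne_eq, ← swapVal_eq_none_iff, hγ]; simp
    obtain ⟨y', hy'⟩ := Option.ne_none_iff_exists'.1 h3
    obtain ⟨z', hz'⟩ := Option.ne_none_iff_exists'.1 h4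
    obtain ⟨w, hw⟩ := hD.convex h1 h2 hy' hz'
    simp [hw]

lemma DotIncreasing.swapUp {a : ℤ} {D : L → Option ZDot} (hD : DotIncreasing (a - 1) D) (n : ℕ) :
    DotIncreasing (a + n - 1) (swapUp a n D) := by
  induction n with
  | zero => simpa [_root_.swapUp] using hD
  | succ n ih =>
    have := ih.swapVal
    rw [show a + n - 1 + 1 = a + n by ring] at this
    rw [show a + (n + 1 : ℕ) - 1 = a + n by push_cast; ring]
    exact this

lemma swapUp_eq_none_iff {a : ℤ} {D : L → Option ZDot} (n : ℕ) {α : L} :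
    swapUp a n D α = none ↔ D α = none := by
  induction n with
  | zero => rfl
  | succ n ih => rw [← ih]; exact swapVal_eq_none_iff

lemma swapUp_eq_inl_iff {a y : ℤ} {D : L → Option ZDot} {n m : ℕ} (hnm : n ≤ m)
    (h : y < a + n ∨ a + m ≤ y) {α : L} :
    swapUp a m D α = some (Sum.inl y) ↔ swapUp a n D α = some (Sum.inl y) := by
  induction m, hnm using Nat.le_induction with
  | base => rfl
  | succ m hm ih =>
    rw [← ih (by push_cast at h; omega)]
    refine swapVal_eq_some_iff (fun e => ?_) (by simp)
    rw [Sum.inl.injEq] at e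
    push_cast at h
    omega

end Swap

lemma restrictInt_eq_some_iff {L : Type} {D : L → Option ZDot} {α : L} {y : ℤ} :
    restrictInt D α = some y ↔ D α = some (Sum.inl y) := by
  unfold restrictInt
  rcases hD : D α with _ | (v | v) <;> simp

lemma neighbor_iff {i c : ℕ} {β : ℕ × ℕ} : Neighbor (i, c) β ↔
    β = (i, c + 1) ∨ β = (i + 1, c) ∨ (∃ k, c = k + 1 ∧ β = (i, k)) ∨
      ∃ k, i = k + 1 ∧ β = (k, c) := by
  obtain ⟨j, d⟩ := β
  unfold Neighbor
  rw [Prod.mk_covBy_mk_iff, Prod.mk_covBy_mk_iff]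
  simp only [Order.covBy_iff_add_one_eq, Prod.mk.injEq]
  constructor
  · rintro ((⟨rfl, rfl⟩ | ⟨rfl, rfl⟩) | (⟨rfl, rfl⟩ | ⟨rfl, rfl⟩)) <;> simp
  · rintro (⟨rfl, rfl⟩ | ⟨rfl, rfl⟩ | ⟨k, rfl, rfl, rfl⟩ | ⟨k, rfl, rfl, rfl⟩) <;> simp

namespace DotIncreasing

variable {t : ℤ} {D : ℕ × ℕ → Option ZDot}

lemma col_lt (hD : DotIncreasing t D) {i j c d : ℕ} {y z : ZDot} (hij : j ≤ i)
    (hy : D (i, c) = some y) (hz : D (j, d) = some z) (h : dotKey t z < dotKey t y) :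
    j < i ∨ d < c := by
  by_contra! hcon
  obtain ⟨h1, h2⟩ := hcon
  obtain rfl : i = j := le_antisymm h1 hij
  rcases h2.lt_or_eq with h2 | rfl
  · exact absurd (hD.key_lt (Prod.mk_lt_mk_iff_right.2 h2) hy hz) (by omega)
  · rw [hy] at hz; simp at hz; subst hz; omega

lemma col_unique (hD : DotIncreasing t D) {i c d : ℕ} {y : ZDot}
    (hy : D (i, c) = some y) (hz : D (i, d) = some y) : c = d := by
  rcases lt_trichotomy c d with h | h | h
  · exact absurd (hD.key_lt (Prod.mk_lt_mk_iff_right.2 h) hy hz) (lt_irrefl _)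
  · exact h
  · exact absurd (hD.key_lt (Prod.mk_lt_mk_iff_right.2 h) hz hy) (lt_irrefl _)

lemma col_succ (hD : DotIncreasing t D) {i c d : ℕ} {y z : ZDot}
    (hy : D (i, c) = some y) (hz : D (i, d) = some z) (h : dotKey t y < dotKey t z)
    (hn : ∀ w, dotKey t y < dotKey t w → ¬ dotKey t w < dotKey t z) : d = c + 1 := by
  have h1 : c < d := by
    rcases hD.col_lt le_rfl hz hy h with h | h
    · exact absurd h (lt_irrefl _)
    · exact h
  by_contra hne
  obtain ⟨w, -, hw1, hw2⟩ := hD.exists_between (β := (i, c + 1))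
    (Prod.mk_lt_mk_iff_right.2 (by omega)) (Prod.mk_lt_mk_iff_right.2 (by omega)) hy hz
  exact hn w hw1 hw2

lemma col_lt_of_row_succ (hD : DotIncreasing t D) {i c d : ℕ} {y z : ZDot}
    (hy : D (i, c) = some y) (hz : D (i + 1, d) = some z) (h : dotKey t z ≤ dotKey t y) :
    d < c := by
  by_contra! hcd
  exact absurd (hD.key_lt (Prod.mk_lt_mk_of_lt_of_le (Nat.lt_succ_self i) hcd) hy hz) (by omega)

lemma exists_neighbor_inr_iff (hD : DotIncreasing t D) {i c : ℕ} {x : ℤ} (hx : x = t + 1)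
    (h : D (i, c) = some (Sum.inl x)) :
    (∃ β, Neighbor (i, c) β ∧ D β = some (Sum.inr ())) ↔
      (∃ k, c = k + 1 ∧ D (i, k) = some (Sum.inr ())) ∨
        ∃ k, i = k + 1 ∧ D (k, c) = some (Sum.inr ()) := by
  constructor
  · rintro ⟨β, hβ, hd⟩
    have hlt : ¬ (i, c) < β := fun hlt => by
      have := hD.key_lt hlt h hd
      simp at this
      omega
    rcases neighbor_iff.1 hβ with rfl | rfl | ⟨k, rfl, rfl⟩ | ⟨k, rfl, rfl⟩
    · exact absurd (Prod.mk_lt_mk_iff_right.2 (Nat.lt_succ_self c)) hlt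
    · exact absurd (Prod.mk_lt_mk_iff_left.2 (Nat.lt_succ_self i)) hlt
    · exact Or.inl ⟨k, rfl, hd⟩
    · exact Or.inr ⟨k, rfl, hd⟩
  · rintro (⟨k, rfl, hd⟩ | ⟨k, rfl, hd⟩)
    · exact ⟨_, neighbor_iff.2 (Or.inr (Or.inr (Or.inl ⟨k, rfl, rfl⟩))), hd⟩
    · exact ⟨_, neighbor_iff.2 (Or.inr (Or.inr (Or.inr ⟨k, rfl, rfl⟩))), hd⟩

lemma exists_neighbor_inl_iff (hD : DotIncreasing t D) {i c : ℕ} {x : ℤ} (hx : x = t + 1)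
    (h : D (i, c) = some (Sum.inr ())) :
    (∃ β, Neighbor (i, c) β ∧ D β = some (Sum.inl x)) ↔
      D (i, c + 1) = some (Sum.inl x) ∨ D (i + 1, c) = some (Sum.inl x) := by
  constructor
  · rintro ⟨β, hβ, hd⟩
    have hlt : ¬ β < (i, c) := fun hlt => by
      have := hD.key_lt hlt hd h
      simp at this
      omega
    rcases neighbor_iff.1 hβ with rfl | rfl | ⟨k, rfl, rfl⟩ | ⟨k, rfl, rfl⟩
    · exact Or.inl hd
    · exact Or.inr hd
    · exact absurd (Prod.mk_lt_mk_iff_right.2 (Nat.lt_succ_self k)) hlt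
    · exact absurd (Prod.mk_lt_mk_iff_left.2 (Nat.lt_succ_self k)) hlt
  · rintro (hd | hd)
    · exact ⟨_, neighbor_iff.2 (Or.inl rfl), hd⟩
    · exact ⟨_, neighbor_iff.2 (Or.inr (Or.inl rfl)), hd⟩

lemma swapVal_eq_inl_iff (hD : DotIncreasing t D) {x : ℤ} (hx : x = t + 1) (i c : ℕ) :
    _root_.swapVal (Sum.inl x) (Sum.inr ()) D (i, c) = some (Sum.inl x) ↔
      (D (i, c) = some (Sum.inl x) ∧ ¬ (∃ k, c = k + 1 ∧ D (i, k) = some (Sum.inr ())) ∧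
        ¬ ∃ k, i = k + 1 ∧ D (k, c) = some (Sum.inr ())) ∨
      (D (i, c) = some (Sum.inr ()) ∧
        (D (i, c + 1) = some (Sum.inl x) ∨ D (i + 1, c) = some (Sum.inl x))) := by
  unfold _root_.swapVal
  by_cases h1 : D (i, c) = some (Sum.inl x)
  · rw [hD.exists_neighbor_inr_iff hx h1]
    simp [h1, -not_exists, -not_and]
  · by_cases h2 : D (i, c) = some (Sum.inr ())
    · rw [hD.exists_neighbor_inl_iff hx h2]
      simp [h2, or_iff_not_imp_left]
    · simp [h1, h2]

lemma swapVal_eq_inr_iff (hD : DotIncreasing t D) {x : ℤ} (hx : x = t + 1) (i c : ℕ) :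
    _root_.swapVal (Sum.inl x) (Sum.inr ()) D (i, c) = some (Sum.inr ()) ↔
      (D (i, c) = some (Sum.inl x) ∧ ((∃ k, c = k + 1 ∧ D (i, k) = some (Sum.inr ())) ∨
        ∃ k, i = k + 1 ∧ D (k, c) = some (Sum.inr ()))) ∨
      (D (i, c) = some (Sum.inr ()) ∧
        ¬ D (i, c + 1) = some (Sum.inl x) ∧ ¬ D (i + 1, c) = some (Sum.inl x)) := by
  unfold _root_.swapVal
  by_cases h1 : D (i, c) = some (Sum.inl x)
  · rw [hD.exists_neighbor_inr_iff hx h1]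
    simp [h1, -not_exists, not_and_or, -not_and]
  · by_cases h2 : D (i, c) = some (Sum.inr ())
    · rw [hD.exists_neighbor_inl_iff hx h2]
      simp [h2]
    · simp [h1, h2]

theorem rowTransition (hD : DotIncreasing t D) {x : ℤ} (hx : x = t + 1) (i : ℕ)
    {q q' p p' : ℤ → Prop}
    (hq : q x ↔ ∃ c, D (i + 1, c) = some (Sum.inl x))
    (hq' : q' x ↔ (∃ c, D (i + 1, c) = some (Sum.inl x)) ∧
      ∃ c, _root_.swapVal (Sum.inl x) (Sum.inr ()) D (i + 1, c) = some (Sum.inl x))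
    (hp : p x ↔ (∃ c, D (i, c) = some (Sum.inl x)) ∧
      ∃ c, _root_.swapVal (Sum.inl x) (Sum.inr ()) D (i, c) = some (Sum.inl x))
    (hp' : p' x ↔ ∃ c, _root_.swapVal (Sum.inl x) (Sum.inr ()) D (i, c) = some (Sum.inl x))
    (hpt : p' (x - 1) → ∃ c, D (i, c) = some (Sum.inl (x - 1)))
    (hqs : q (x + 1) → ∃ c, D (i + 1, c) = some (Sum.inl (x + 1))) :
    RowTransition q q' p p'
      (∃ c, D (i, c + 1) = some (Sum.inr ()) ∧ D (i + 1, c) = some (Sum.inr ()))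
      (∃ c, _root_.swapVal (Sum.inl x) (Sum.inr ()) D (i, c + 1) = some (Sum.inr ()) ∧
        _root_.swapVal (Sum.inl x) (Sum.inr ()) D (i + 1, c) = some (Sum.inr ())) x := by
  subst hx
  refine rowTransition_of_positions
    (At := fun c => ∃ k, i = k + 1 ∧ D (k, c) = some (Sum.inr ()))
    (Ub := fun c => D (i + 1 + 1, c) = some (Sum.inl (t + 1)))
    (fun c => hD.swapVal_eq_inl_iff rfl i c) (fun c => hD.swapVal_eq_inr_iff rfl i c) ?_ ?_
    (fun c d h1 h2 => hD.col_unique h1 h2) (fun c d h1 h2 => hD.col_unique h1 h2)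
    (fun c d h1 h2 => hD.col_unique h1 h2) (fun c d h1 h2 => hD.col_unique h1 h2)
    ?_ ?_ (fun c d h1 h2 => hD.col_lt_of_row_succ h1 h2 le_rfl) ?_ ?_
    (fun c d h1 h2 => hD.col_lt_of_row_succ h1 h2 le_rfl) ?_ ?_ ?_ ?_ hq hq' hp hp' hpt hqs
  · intro c
    rw [hD.swapVal_eq_inl_iff rfl]
    simp
  · intro c
    rw [hD.swapVal_eq_inr_iff rfl]
    simp
  · intro c d h1 h2
    refine hD.col_succ h1 h2 (by simp; omega) fun w => ?_
    rcases w with w | w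
    · simp
      omega
    · simp
  · intro c d h1 h2
    refine hD.col_succ h1 h2 (by simp; omega) fun w => ?_
    rcases w with w | w
    · simp
      omega
    · simp
  · intro c d h1 h2
    by_contra! hcd
    obtain ⟨w, -, hw1, hw2⟩ := hD.exists_between (β := (i, d))
      (Prod.mk_lt_mk_iff_right.2 hcd) (Prod.mk_lt_mk_iff_left.2 (Nat.lt_succ_self i)) h1 h2
    rcases w with w | w <;> simp at hw1 hw2
    omega
  · intro c d h1 h2
    by_contra! hcd
    have := hD.key_lt (Prod.mk_lt_mk_of_lt_of_le (Nat.lt_succ_self i) hcd) h1 h2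
    simp at this
  · intro c d h1 h2
    refine hD.col_succ h1 h2 (by simp) fun w => ?_
    rcases w with w | w <;> simp
  · intro c h1 h2 h3
    obtain ⟨w, hw, hw1, hw2⟩ := hD.exists_between (β := (i + 1, c))
      (Prod.mk_lt_mk_iff_left.2 (Nat.lt_succ_self i))
      (Prod.mk_lt_mk_iff_right.2 (Nat.lt_succ_self c)) h1 h3
    rcases w with w | ⟨⟩ <;> simp at hw1 hw2
    · omega
    · exact hw
  · intro c h1 h2
    obtain ⟨w, hw, hw1, hw2⟩ := hD.exists_between (β := (i, c + 1))
      (Prod.mk_lt_mk_iff_right.2 (Nat.lt_succ_self c))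
      (Prod.mk_lt_mk_iff_left.2 (Nat.lt_succ_self i)) h1 h2
    rcases w with w | ⟨⟩ <;> simp at hw1 hw2
    obtain rfl : w = t + 1 := by omega
    exact hw
  · intro c d h1 h2
    refine hD.col_succ h1 h2 (by simp) fun w => ?_
    rcases w with w | w <;> simp

end DotIncreasing

/-- The set of values in row `r` of a tableau. -/
def rowValues (T : ℕ × ℕ → Option ℤ) (r : ℕ) (v : ℤ) : Prop := ∃ c, T (r, c) = some v

lemma rowValues_restrictInt {D : ℕ × ℕ → Option ZDot} {r : ℕ} {v : ℤ} :
    rowValues (restrictInt D) r v ↔ ∃ c, D (r, c) = some (Sum.inl v) := by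
  simp only [rowValues, restrictInt_eq_some_iff]

section RowsProduct

variable {M : Type} [Monoid M]

/-- The product `H (k - 1) * ⋯ * H 0`. -/
def rowsProd (H : ℕ → M) : ℕ → M
  | 0 => 1
  | k + 1 => H k * rowsProd H k

lemma rowsProd_succ_eq {H H' G : ℕ → M} (h0 : G 0 = H 0)
    (h : ∀ k, H (k + 1) * G k = G (k + 1) * H' k) (K : ℕ) :
    rowsProd H (K + 1) = G K * rowsProd H' K := by
  induction K with
  | zero => simp [rowsProd, h0]
  | succ K ih =>
    rw [rowsProd, ih, ← mul_assoc, h, mul_assoc]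
    rfl

lemma rowsProd_eq_of_le {H : ℕ → M} {k m : ℕ} (hkm : k ≤ m) (h : ∀ j, k ≤ j → H j = 1) :
    rowsProd H m = rowsProd H k := by
  induction m, hkm using Nat.le_induction with
  | base => rfl
  | succ m hm ih => rw [rowsProd, h m hm, one_mul, ih]

variable {σ : ℤ → M}

lemma rowProdLeft_congr {p q : ℤ → Prop} {a : ℤ} {n : ℕ}
    (h : ∀ v, a ≤ v → v < a + n → (p v ↔ q v)) : rowProdLeft σ p a n = rowProdLeft σ q a n := by
  induction n with
  | zero => rfl
  | succ n ih =>
    rw [rowProdLeft, rowProdLeft, ih fun v h1 h2 => h v h1 (by push_cast; omega)]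
    simp only [rowLetter, h (a + n) (by omega) (by push_cast; omega)]

lemma rowProdLeft_eq_one {p : ℤ → Prop} (h : ∀ v, ¬ p v) (a : ℤ) (n : ℕ) :
    rowProdLeft σ p a n = 1 := by
  induction n with
  | zero => rfl
  | succ n ih => rw [rowProdLeft, ih, rowLetter, if_neg (h _), one_mul]

lemma rowProdLeft_eq_prod (p : ℤ → Prop) (a : ℤ) (n : ℕ) : rowProdLeft σ p a n =
    ((((List.range n).map fun k : ℕ => a + k).filter fun v => p v).map σ).prod := by
  induction n with
  | zero => rfl
  | succ n ih =>
    rw [rowProdLeft, ih, rowLetter, List.range_succ]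
    by_cases h : p (a + n) <;> simp [h]

theorem rowProdLeft_swapUp (hσ : IsZeroHecke σ) {a : ℤ} {D : ℕ × ℕ → Option ZDot}
    (hD : DotIncreasing (a - 1) D) (N i : ℕ) {q p q' p' : ℤ → Prop}
    (hq : q = rowValues (restrictInt D) (i + 1)) (hp : p = rowValues (restrictInt D) i)
    (hq' : q' = rowValues (restrictInt (swapUp a N D)) (i + 1))
    (hp' : p' = rowValues (restrictInt (swapUp a N D)) i) :
    rowProdLeft σ q a N * rowProdLeft σ (fun v => p v ∧ p' v) a N =
      rowProdLeft σ (fun v => q v ∧ q' v) a N * rowProdLeft σ p' a N := by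
  subst hq hp hq' hp'
  refine rowProd_mul_rowProd_eq hσ (fun n => ∃ c, swapUp a n D (i, c + 1) = some (Sum.inr ()) ∧
    swapUp a n D (i + 1, c) = some (Sum.inr ())) fun n hn => ?_
  have hn1 : ∀ (r : ℕ), rowValues (restrictInt D) r (a + n) ↔
      ∃ c, swapUp a n D (r, c) = some (Sum.inl (a + n)) := fun r => by
    rw [rowValues_restrictInt]
    simp only [swapUp_eq_inl_iff (Nat.zero_le n) (Or.inr (le_refl (a + n)))]
    rfl
  have hn2 : ∀ (r : ℕ), rowValues (restrictInt (swapUp a N D)) r (a + n) ↔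
      ∃ c, swapUp a (n + 1) D (r, c) = some (Sum.inl (a + n)) := fun r => by
    rw [rowValues_restrictInt]
    simp only [swapUp_eq_inl_iff (a := a) (y := a + n) (Nat.succ_le_of_lt hn)
      (Or.inl (by push_cast; omega))]
  refine (hD.swapUp n).rowTransition (by ring) i (hn1 _) (and_congr (hn1 _) (hn2 _))
    (and_congr (hn1 _) (hn2 _)) (hn2 _) ?_ ?_
  · rw [rowValues_restrictInt]
    simp only [swapUp_eq_inl_iff (a := a) (y := a + n - 1) hn.le (Or.inl (by omega)), imp_self]
  · rw [rowValues_restrictInt]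
    simp only [swapUp_eq_inl_iff (a := a) (y := a + n + 1) (Nat.zero_le n) (Or.inr (by omega))]
    exact id

lemma rowValues_zero_swapUp {a : ℤ} {D : ℕ × ℕ → Option ZDot}
    (hD : DotIncreasing (a - 1) D) (N : ℕ) {v : ℤ} (h : rowValues (restrictInt D) 0 v) :
    rowValues (restrictInt (swapUp a N D)) 0 v := by
  induction N with
  | zero => exact h
  | succ n ih =>
    rw [rowValues_restrictInt] at ih ⊢
    obtain ⟨c, hc⟩ := ih
    by_cases hv : v = a + n
    · subst hv
      have hDn := hD.swapUp n
      by_cases hk : ∃ k, c = k + 1 ∧ swapUp a n D (0, k) = some (Sum.inr ())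
      · obtain ⟨k, rfl, hk⟩ := hk
        exact ⟨k, (hDn.swapVal_eq_inl_iff (by ring) 0 k).2 (Or.inr ⟨hk, Or.inl hc⟩)⟩
      · exact ⟨c, (hDn.swapVal_eq_inl_iff (by ring) 0 c).2
          (Or.inl ⟨hc, hk, fun ⟨k, hk, _⟩ => Nat.succ_ne_zero k hk.symm⟩)⟩
    · exact ⟨c, (swapVal_eq_some_iff (by simpa using hv) (by simp)).2 hc⟩

/-- The product attached to the rows of an increasing dotted tableau does not change under
swapping dots past all values. -/
theorem rowsProd_swapUp (hσ : IsZeroHecke σ) {a : ℤ} {D : ℕ × ℕ → Option ZDot}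
    (hD : DotIncreasing (a - 1) D) (N : ℕ) {K : ℕ} (hK : ∀ r c, K ≤ r → D (r, c) = none) :
    rowsProd (fun r => rowProdLeft σ (rowValues (restrictInt D) r) a N) K =
      rowsProd (fun r => rowProdLeft σ (rowValues (restrictInt (swapUp a N D)) r) a N) K := by
  have hone : rowProdLeft σ (rowValues (restrictInt D) K) a N = 1 :=
    rowProdLeft_eq_one (fun v => by simp [rowValues_restrictInt, hK K _ le_rfl]) a N
  have h := rowsProd_succ_eq
    (G := fun r => rowProdLeft σ (fun v => rowValues (restrictInt D) r v ∧
      rowValues (restrictInt (swapUp a N D)) r v) a N)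
    (H := fun r => rowProdLeft σ (rowValues (restrictInt D) r) a N)
    (H' := fun r => rowProdLeft σ (rowValues (restrictInt (swapUp a N D)) r) a N)
    (rowProdLeft_congr fun v _ _ => and_iff_left_of_imp (rowValues_zero_swapUp hD N))
    (fun k => rowProdLeft_swapUp hσ hD N k rfl rfl rfl rfl) K
  rw [rowsProd, hone, one_mul] at h
  rw [h, rowProdLeft_eq_one (fun v => by simp [rowValues_restrictInt, hK K _ le_rfl]) a N, one_mul]

end RowsProduct

/-- The word of row `r` of a tableau. -/
def rowList (T : ℕ × ℕ → Option ℤ) (cmax r : ℕ) : List ℤ :=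
  (List.range (cmax + 1)).filterMap fun c => T (r, c)

lemma pairwise_rowList {T : ℕ × ℕ → Option ℤ} (hT : Increasing T) (cmax r : ℕ) :
    (rowList T cmax r).Pairwise (· < ·) := by
  unfold rowList
  rw [List.pairwise_filterMap]
  exact List.pairwise_lt_range.imp fun hcd v hv w hw =>
    hT _ _ (Prod.mk_lt_mk_iff_right.2 hcd) v w hv hw

lemma mem_rowList {T : ℕ × ℕ → Option ℤ} {rmax cmax : ℕ} (hb : BoundedBy T rmax cmax)
    {r : ℕ} {v : ℤ} : v ∈ rowList T cmax r ↔ rowValues T r v := by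
  unfold rowList rowValues
  simp only [List.mem_filterMap, List.mem_range]
  refine ⟨fun ⟨c, _, h⟩ => ⟨c, h⟩, fun ⟨c, h⟩ => ⟨c, ?_, h⟩⟩
  have := (hb (r, c) (by simp [h])).2
  exact Nat.lt_succ_of_le this

lemma rowValues_lt {T : ℕ × ℕ → Option ℤ} {rmax cmax : ℕ} (hb : BoundedBy T rmax cmax)
    {r : ℕ} {v : ℤ} (h : rowValues T r v) : r < rmax + 1 := by
  obtain ⟨c, h⟩ := h
  exact Nat.lt_succ_of_le (hb (r, c) (by simp [h])).1

section WordProducts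

variable {M : Type} [Monoid M] {σ : ℤ → M}

lemma prod_rowList {T : ℕ × ℕ → Option ℤ} (hT : Increasing T) {rmax cmax : ℕ}
    (hb : BoundedBy T rmax cmax) {a : ℤ} {N : ℕ}
    (hv : ∀ α v, T α = some v → a ≤ v ∧ v < a + N) (r : ℕ) :
    ((rowList T cmax r).map σ).prod = rowProdLeft σ (rowValues T r) a N := by
  rw [rowProdLeft_eq_prod]
  congr 2
  refine (pairwise_rowList hT cmax r).eq_of_mem_iff ?_ fun v => ?_
  · refine List.Pairwise.filter _ (List.pairwise_map.2 ?_)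
    exact List.pairwise_lt_range.imp fun h => by omega
  · rw [mem_rowList hb]
    simp only [List.mem_filter, List.mem_map, List.mem_range, decide_eq_true_eq]
    refine ⟨fun h => ⟨?_, h⟩, And.right⟩
    obtain ⟨c, hc⟩ := h
    have := hv _ _ hc
    exact ⟨(v - a).toNat, by omega, by omega⟩

lemma prod_flatMap_reverse_range (f : ℕ → List ℤ) (K : ℕ) :
    (((List.range K).reverse.flatMap f).map σ).prod = rowsProd (fun r => ((f r).map σ).prod) K := by
  induction K with
  | zero => rfl
  | succ K ih =>
    rw [List.range_succ, List.reverse_append, rowsProd, ← ih]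
    simp

lemma prod_rowWord {T : ℕ × ℕ → Option ℤ} (hT : Increasing T) {rmax cmax : ℕ}
    (hb : BoundedBy T rmax cmax) {a : ℤ} {N : ℕ}
    (hv : ∀ α v, T α = some v → a ≤ v ∧ v < a + N) {K : ℕ} (hK : rmax + 1 ≤ K) :
    ((rowWord T rmax cmax).map σ).prod =
      rowsProd (fun r => rowProdLeft σ (rowValues T r) a N) K := by
  rw [rowsProd_eq_of_le hK fun j hj => rowProdLeft_eq_one
    (fun v h => absurd (rowValues_lt hb h) (by omega)) a N]
  simp only [← prod_rowList hT hb hv]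
  exact prod_flatMap_reverse_range _ _

end WordProducts

lemma heckeWord_eq_of_prod_eq {l m : List ℤ}
    (h : (l.map demazureGen).prod = (m.map demazureGen).prod) : heckeWord l = heckeWord m := by
  rw [heckeWord_eq, heckeWord_eq, ← unop_prod_demazureGen, ← unop_prod_demazureGen, h]

lemma addDots_toDotted_cases {L : Type} {C : Finset L} {T : L → Option ℤ} {α : L} {y : ZDot}
    (h : addDots C (toDotted T) α = some y) :
    (α ∈ C ∧ y = Sum.inr ()) ∨ (α ∉ C ∧ ∃ v, T α = some v ∧ y = Sum.inl v) := by
  unfold addDots toDotted at h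
  split_ifs at h with hα
  · simp only [Option.some.injEq] at h
    exact Or.inl ⟨hα, h.symm⟩
  · simp only [Option.map_eq_some_iff] at h
    obtain ⟨v, hv, rfl⟩ := h
    exact Or.inr ⟨hα, v, hv, rfl⟩

lemma restrictInt_addDots {L : Type} {lam nu C : Finset L} {T : L → Option ℤ}
    (hT : shapeOf T = (nu : Set L) \ (lam : Set L)) (hC : C ⊆ lam) :
    restrictInt (addDots C (toDotted T)) = T := by
  funext α
  unfold restrictInt addDots toDotted
  by_cases hα : α ∈ C
  · have : α ∉ shapeOf T := by simp [hT, hC hα]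
    simp only [shapeOf, Set.mem_ofPred_eq, not_not] at this
    simp [hα, this]
  · cases h : T α <;> simp [hα]

lemma ValuesIn.lt_add_toNat {L : Type} {T : L → Option ℤ} {a b : ℤ} (hv : ValuesIn T a b) (α : L) (v : ℤ)
    (h : T α = some v) : a ≤ v ∧ v < a + (b - a + 1).toNat := by
  have := hv α v h
  omega

section Slide

variable {L : Type} [PartialOrder L]

lemma addDots_ne_none_iff {lam nu C : Finset L} {T : L → Option ℤ} (hs : IsSkewPair lam nu)
    (hT : shapeOf T = (nu : Set L) \ (lam : Set L)) (hC : C ⊆ lam) {α : L} :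
    addDots C (toDotted T) α ≠ none ↔ α ∈ nu ∧ α ∉ lam \ C := by
  rw [Finset.mem_sdiff, not_and_not_right]
  have hα : T α ≠ none ↔ α ∈ nu ∧ α ∉ lam := by
    have : α ∈ shapeOf T ↔ α ∈ (nu : Set L) \ (lam : Set L) := by rw [hT]
    simpa [shapeOf] using this
  unfold addDots toDotted
  by_cases h : α ∈ C
  · simp [h, hs.2.2 (hC h)]
  · simpa [h] using hα

lemma dotIncreasing_addDots {lam nu C : Finset L} {T : L → Option ℤ} {a b : ℤ}
    (hs : IsSkewPair lam nu) (hT : shapeOf T = (nu : Set L) \ (lam : Set L))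
    (hi : Increasing T) (hv : ValuesIn T a b)
    (hC : ∀ c ∈ C, c ∈ lam ∧ ∀ d ∈ lam, ¬ c < d) :
    DotIncreasing (a - 1) (addDots C (toDotted T)) where
  key_lt := by
    intro α β y z hlt hy hz
    rcases addDots_toDotted_cases hy with ⟨h1, rfl⟩ | ⟨h1, v, hv1, rfl⟩ <;>
      rcases addDots_toDotted_cases hz with ⟨h2, rfl⟩ | ⟨h2, w, hw1, rfl⟩
    · exact absurd hlt ((hC α h1).2 β (hC β h2).1)
    · have := (hv _ _ hw1).1
      simp
      omega
    · have h3 : α ∈ lam := hs.1 β (hC β h2).1 α hlt.le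
      have h4 : α ∈ shapeOf T := by simp [shapeOf, hv1]
      rw [hT] at h4
      exact absurd h3 h4.2
    · simpa using hi α β hlt v w hv1 hw1
  convex := by
    intro α β γ y z h1 h2 hα hγ
    have hsub : C ⊆ lam := fun c hc => (hC c hc).1
    have key := fun δ => addDots_ne_none_iff hs hT hsub (α := δ)
    simp only [Finset.mem_sdiff, not_and_not_right] at key
    have hα' := (key α).1 (by simp [hα])
    have hγ' := (key γ).1 (by simp [hγ])
    refine Option.ne_none_iff_exists'.1 ((key β).2 ⟨hs.2.1 γ hγ'.1 β h2, fun hβ => ?_⟩)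
    have hαC := hα'.2 (hs.1 β hβ α h1)
    rcases h1.lt_or_eq with h1 | rfl
    · exact absurd h1 ((hC α hαC).2 β hβ)
    · exact hαC

lemma isSkewPair_sdiff {lam nu C : Finset L} (hs : IsSkewPair lam nu)
    (hC : ∀ c ∈ C, c ∈ lam ∧ ∀ d ∈ lam, ¬ c < d) : IsSkewPair (lam \ C) nu := by
  refine ⟨fun α hα β hβ => ?_, hs.2.1, fun α hα => hs.2.2 (Finset.mem_sdiff.1 hα).1⟩
  rw [Finset.mem_sdiff] at hα ⊢
  refine ⟨hs.1 α hα.1 β hβ, fun hβC => ?_⟩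
  rcases hβ.lt_or_eq with hβ | rfl
  · exact (hC β hβC).2 α hα.1 hβ
  · exact hα.2 hβC

lemma lt_of_swapUp_restrict {a : ℤ} {N : ℕ} {D : L → Option ZDot}
    (hv : ∀ α v, restrictInt D α = some v → a ≤ v ∧ v < a + N) {α : L} {v : ℤ}
    (h : swapUp a N D α = some (Sum.inl v)) : a ≤ v ∧ v < a + N := by
  by_contra hcon
  rw [swapUp_eq_inl_iff (a := a) (y := v) (Nat.zero_le N) (by push_cast; omega)] at h
  exact hcon (hv α v (restrictInt_eq_some_iff.2 h))

lemma DotIncreasing.exists_shape {a : ℤ} {N : ℕ} {D : L → Option ZDot}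
    (hD : DotIncreasing (a - 1) D) (hv : ∀ α v, restrictInt D α = some v → a ≤ v ∧ v < a + N)
    {lam nu : Finset L} (hs : IsSkewPair lam nu) (hsupp : ∀ α, D α ≠ none ↔ α ∈ nu ∧ α ∉ lam) :
    ∃ nu' : Finset L, IsSkewPair lam nu' ∧
      shapeOf (restrictInt (_root_.swapUp a N D)) = (nu' : Set L) \ (lam : Set L) := by
  have hDN := hD.swapUp N
  have hsuppN : ∀ α, _root_.swapUp a N D α ≠ none ↔ α ∈ nu ∧ α ∉ lam := fun α => by
    rw [← hsupp, ne_eq, swapUp_eq_none_iff]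
  have hmax : ∀ α β, α < β → _root_.swapUp a N D α = some (Sum.inr ()) → _root_.swapUp a N D β = none := by
    intro α β hlt hα
    by_contra hβ
    obtain ⟨v | v, hv'⟩ := Option.ne_none_iff_exists'.1 hβ
    · have h1 := hDN.key_lt hlt hα hv'
      have h2 := lt_of_swapUp_restrict hv hv'
      simp at h1
      omega
    · exact absurd (hDN.key_lt hlt hα hv') (lt_irrefl _)
  refine ⟨nu.filter fun α => _root_.swapUp a N D α ≠ some (Sum.inr ()), ⟨hs.1, ?_, ?_⟩, ?_⟩
  · intro α hα β hβ
    rw [Finset.mem_filter] at hα ⊢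
    refine ⟨hs.2.1 α hα.1 β hβ, fun hd => ?_⟩
    rcases hβ.lt_or_eq with hlt | rfl
    · have h1 := ((hsuppN β).1 (by simp [hd])).2
      exact (hsuppN α).2 ⟨hα.1, fun h2 => h1 (hs.1 α h2 β hβ)⟩ (hmax β α hlt hd)
    · exact hα.2 hd
  · intro α hα
    refine Finset.mem_filter.2 ⟨hs.2.2 hα, fun hd => ((hsuppN α).1 (by simp [hd])).2 hα⟩
  · ext α
    have h1 := hsuppN α
    simp only [shapeOf, Set.mem_ofPred_eq, Set.mem_sdiff, Finset.mem_coe, Finset.mem_filter]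
    unfold restrictInt
    rcases hd : _root_.swapUp a N D α with _ | (v | v) <;> simp [hd] at h1 ⊢ <;> tauto

lemma DotIncreasing.increasing {t : ℤ} {D : L → Option ZDot} (hD : DotIncreasing t D) :
    Increasing (restrictInt D) := by
  intro α β hlt x y hx hy
  rw [restrictInt_eq_some_iff] at hx hy
  simpa using hD.key_lt hlt hx hy

/-- A slide into the set `C` of maximal boxes of `lam` produces an increasing tableau whose inner
shape is `lam` without `C`. -/
theorem exists_shape_slide {T : L → Option ℤ} (hi : Increasing T) {lam nu C : Finset L} {a b : ℤ}
    (hs : IsSkewPair lam nu) (hT : shapeOf T = (nu : Set L) \ (lam : Set L))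
    (hv : ValuesIn T a b) (hC : ∀ c ∈ C, c ∈ lam ∧ ∀ d ∈ lam, ¬ c < d) :
    Increasing (restrictInt (swapUp a (b - a + 1).toNat (addDots C (toDotted T)))) ∧
    ∃ nu' : Finset L, IsSkewPair (lam \ C) nu' ∧
      shapeOf (restrictInt (swapUp a (b - a + 1).toNat (addDots C (toDotted T)))) =
        (nu' : Set L) \ ((lam \ C : Finset L) : Set L) := by
  have hsub : C ⊆ lam := fun c hc => (hC c hc).1
  have hD := dotIncreasing_addDots hs hT hi hv hC
  refine ⟨(hD.swapUp _).increasing, hD.exists_shape ?_ (isSkewPair_sdiff hs hC)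
    fun α => addDots_ne_none_iff hs hT hsub⟩
  rw [restrictInt_addDots hT hsub]
  exact hv.lt_add_toNat

theorem IsForwardSlide.increasingSkewTableau {T T' : L → Option ℤ} (hi : Increasing T)
    (h : IsForwardSlide T T') : IncreasingSkewTableau T' := by
  obtain ⟨lam, nu, C, a, b, hs, hT, hv, hC, rfl⟩ := h
  obtain ⟨h1, nu', h2⟩ := exists_shape_slide hi hs hT hv hC
  exact ⟨⟨lam \ C, nu', h2⟩, h1⟩

end Slide

theorem IsForwardSlide.heckeWord_eq {T T' : ℕ × ℕ → Option ℤ} (hi : Increasing T)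
    (h : IsForwardSlide T T') {r c r' c' : ℕ} (hb : BoundedBy T r c) (hb' : BoundedBy T' r' c') :
    heckeWord (rowWord T r c) = heckeWord (rowWord T' r' c') := by
  have hi' := (h.increasingSkewTableau hi).2
  obtain ⟨lam, nu, C, a, b, hs, hT, hval, hC, rfl⟩ := h
  have hsub : C ⊆ lam := fun c hc => (hC c hc).1
  have hD := dotIncreasing_addDots hs hT hi hval hC
  have hv := hval.lt_add_toNat
  generalize (b - a + 1).toNat = N at *
  have hsupp := fun α => addDots_ne_none_iff hs hT hsub (α := α)
  have hTD := restrictInt_addDots hT hsub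
  generalize addDots C (toDotted T) = D at *
  subst hTD
  have hv' : ∀ α v, restrictInt (swapUp a N D) α = some v → a ≤ v ∧ v < a + N :=
    fun α v h => lt_of_swapUp_restrict hv (restrictInt_eq_some_iff.1 h)
  obtain ⟨K, hK⟩ : ∃ K, ∀ α ∈ nu, α.1 < K :=
    ⟨nu.sup (fun α => α.1 + 1), fun α hα => Finset.le_sup (f := fun α => α.1 + 1) hα⟩
  apply heckeWord_eq_of_prod_eq
  rw [prod_rowWord hi hb hv (K := max K (max (r + 1) (r' + 1))) (by omega),
    prod_rowWord hi' hb' hv' (K := max K (max (r + 1) (r' + 1))) (by omega)]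
  refine rowsProd_swapUp isZeroHecke_demazureGen hD N fun i j hij => ?_
  by_contra hne
  have := hK _ ((hsupp _).1 hne).1
  simp at this
  omega

lemma exists_valuesIn {L : Type} {T : L → Option ℤ} {lam nu : Finset L}
    (hT : shapeOf T = (nu : Set L) \ (lam : Set L)) : ∃ a b, ValuesIn T a b := by
  refine ⟨-(nu.sup fun α => ((T α).getD 0).natAbs : ℕ), (nu.sup fun α => ((T α).getD 0).natAbs : ℕ),
    fun α x hx => ?_⟩
  have h1 : α ∈ shapeOf T := by simp [shapeOf, hx]
  rw [hT] at h1
  have h2 := Finset.le_sup (f := fun α => ((T α).getD 0).natAbs) h1.1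
  simp only [hx, Option.getD_some] at h2
  omega

section Rectification

variable {L : Type} [PartialOrder L]

/-- Every increasing skew tableau has a rectification. -/
theorem exists_rectifiesTo {T : L → Option ℤ} (hT : IncreasingSkewTableau T) :
    ∃ U, RectifiesTo T U := by
  obtain ⟨⟨lam, nu, hs, hsh⟩, hi⟩ := hT
  induction lam using Finset.strongInduction generalizing T nu with
  | H lam ih =>
  rcases lam.eq_empty_or_nonempty with rfl | hne
  · exact ⟨T, Relation.ReflTransGen.refl, nu, hs.2.1, by simpa using hsh⟩
  · obtain ⟨c, hc⟩ := lam.exists_maximal hne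
    obtain ⟨a, b, hv⟩ := exists_valuesIn hsh
    have hC : ∀ c' ∈ ({c} : Finset L), c' ∈ lam ∧ ∀ d ∈ lam, ¬ c' < d := by
      rintro c' hc'
      rw [Finset.mem_singleton] at hc'
      subst hc'
      exact ⟨hc.prop, fun d hd hlt => hc.not_gt hd hlt⟩
    obtain ⟨h1, nu', h2, h3⟩ := exists_shape_slide hi hs hsh hv hC
    obtain ⟨U, hU, hU'⟩ := ih (lam \ {c})
      (Finset.sdiff_ssubset (Finset.singleton_subset_iff.2 hc.prop) (Finset.singleton_nonempty c))
      h1 nu' h2 h3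
    exact ⟨U, Relation.ReflTransGen.head ⟨lam, nu, {c}, a, b, hs, hsh, hv, hC, rfl⟩ hU, hU'⟩

lemma increasingSkewTableau_of_slides {T U : L → Option ℤ} (hT : IncreasingSkewTableau T)
    (h : Relation.ReflTransGen IsForwardSlide T U) : IncreasingSkewTableau U := by
  induction h with
  | refl => exact hT
  | tail _ h ih => exact h.increasingSkewTableau ih.2

end Rectification

lemma exists_boundedBy {T : ℕ × ℕ → Option ℤ} (hT : HasSkewShape T) : ∃ r c, BoundedBy T r c := by
  obtain ⟨lam, nu, -, hsh⟩ := hT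
  refine ⟨nu.sup Prod.fst, nu.sup Prod.snd, fun p hp => ?_⟩
  have h1 : p ∈ shapeOf T := hp
  rw [hsh] at h1
  exact ⟨Finset.le_sup (f := Prod.fst) h1.1, Finset.le_sup (f := Prod.snd) h1.1⟩

/-- The Hecke permutation is invariant under sequences of forward slides. -/
theorem heckeWord_eq_of_slides {T U : ℕ × ℕ → Option ℤ} (hT : IncreasingSkewTableau T)
    (h : Relation.ReflTransGen IsForwardSlide T U) {r c r' c' : ℕ} (hb : BoundedBy T r c)
    (hb' : BoundedBy U r' c') : heckeWord (rowWord T r c) = heckeWord (rowWord U r' c') := by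
  induction h generalizing r' c' with
  | refl =>
    obtain ⟨⟨lam, nu, -, hsh⟩, hi⟩ := hT
    obtain ⟨a, b, hv⟩ := exists_valuesIn hsh
    apply heckeWord_eq_of_prod_eq
    rw [prod_rowWord hi hb hv.lt_add_toNat (le_max_left _ (r' + 1)),
      prod_rowWord hi hb' hv.lt_add_toNat (le_max_right _ _)]
  | tail h1 h2 ih =>
    have hM := increasingSkewTableau_of_slides hT h1
    obtain ⟨s, d, hM'⟩ := exists_boundedBy hM.1
    exact (ih hM').trans (h2.heckeWord_eq hM.2 hM' hb')

lemma StraightShape.mem_of_le {lam : Finset (ℕ × ℕ)} (hl : StraightShape lam) {i j i' j' : ℕ}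
    (h : (i, j) ∈ lam) (hi : i' ≤ i) (hj : j' ≤ j) : (i', j') ∈ lam :=
  hl _ h _ (Prod.mk_le_mk.2 ⟨hi, hj⟩)

lemma card_le_of_isChain {s : Finset (ℕ × ℕ)} (hs : ∀ a ∈ s, ∀ b ∈ s, a ≤ b ∨ b ≤ a)
    {i j : ℕ} (hle : ∀ a ∈ s, a ≤ (i, j)) : s.card ≤ i + j + 1 := by
  have hmaps : Set.MapsTo (fun a : ℕ × ℕ => a.1 + a.2) s (Finset.range (i + j + 1)) := by
    intro a ha
    have := Prod.le_def.1 (hle a ha)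
    simp at this ⊢
    omega
  have hinj : Set.InjOn (fun a : ℕ × ℕ => a.1 + a.2) s := by
    intro a ha b hb hab
    have h1 := hs a ha b hb
    simp only [Prod.le_def] at h1
    ext <;> simp at hab <;> omega
  simpa using Finset.card_le_card_of_injOn _ hmaps hinj

/-- The hook from `(0, 0)` down to `(i, 0)` and right to `(i, j)`. -/
lemma exists_chain (i j : ℕ) : ∃ s : Finset (ℕ × ℕ), (∀ a ∈ s, ∀ b ∈ s, a ≤ b ∨ b ≤ a) ∧
    (i, j) ∈ s ∧ (∀ a ∈ s, a ≤ (i, j)) ∧ s.card = i + j + 1 := by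
  have hinj : Function.Injective fun k : ℕ => (min k i, k - i) := fun k l h => by
    simp at h
    omega
  refine ⟨(Finset.range (i + j + 1)).image fun k => (min k i, k - i), ?_, ?_, ?_, ?_⟩
  · intro a ha b hb
    obtain ⟨k, -, rfl⟩ := Finset.mem_image.1 ha
    obtain ⟨l, -, rfl⟩ := Finset.mem_image.1 hb
    simp only [Prod.mk_le_mk]
    omega
  · exact Finset.mem_image.2 ⟨i + j, by simp, by simp⟩
  · intro a ha
    obtain ⟨k, hk, rfl⟩ := Finset.mem_image.1 ha
    rw [Finset.mem_range] at hk
    simp only [Prod.mk_le_mk]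
    omega
  · rw [Finset.card_image_of_injective _ hinj, Finset.card_range]

lemma minTab_apply {lam : Finset (ℕ × ℕ)} (hl : StraightShape lam) (i j : ℕ) :
    minTab lam (i, j) = if (i, j) ∈ lam then some ((i : ℤ) + j + 1) else none := by
  unfold minTab
  split_ifs with h
  · congr 1
    suffices hg : IsGreatest {n : ℕ | ∃ s : Finset (ℕ × ℕ), (s : Set (ℕ × ℕ)) ⊆ (lam : Set _) ∧
        (∀ a ∈ s, ∀ b ∈ s, a ≤ b ∨ b ≤ a) ∧ (i, j) ∈ s ∧ (∀ a ∈ s, a ≤ (i, j)) ∧ s.card = n}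
        (i + j + 1) by
      rw [hg.csSup_eq]
      push_cast
      ring
    constructor
    · obtain ⟨s, h1, h2, h3, h4⟩ := exists_chain i j
      exact ⟨s, fun a ha => hl _ h a (h3 a ha), h1, h2, h3, h4⟩
    · rintro n ⟨s, -, h1, -, h3, rfl⟩
      exact card_le_of_isChain h1 h3
  · rfl

lemma minTab_eq_some_iff {lam : Finset (ℕ × ℕ)} (hl : StraightShape lam) {i j : ℕ} {v : ℤ} :
    minTab lam (i, j) = some v ↔ (i, j) ∈ lam ∧ v = i + j + 1 := by
  rw [minTab_apply hl]
  split_ifs with h <;> simp [h, eq_comm]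

lemma hasStraightShape_minTab {lam : Finset (ℕ × ℕ)} (hl : StraightShape lam) :
    HasStraightShape (minTab lam) := by
  refine ⟨lam, hl, ?_⟩
  ext ⟨i, j⟩
  simp [shapeOf, minTab_apply hl]

lemma increasing_minTab {lam : Finset (ℕ × ℕ)} (hl : StraightShape lam) :
    Increasing (minTab lam) := by
  rintro ⟨i, j⟩ ⟨i', j'⟩ hlt x y hx hy
  rw [minTab_eq_some_iff hl] at hx hy
  have := Prod.mk_lt_mk.1 hlt
  omega

/-- The row lengths of a straight shape. -/
lemma exists_rowLength {lam : Finset (ℕ × ℕ)} (hl : StraightShape lam) :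
    ∃ ℓ : ℕ → ℕ, Antitone ℓ ∧ ∀ i j, (i, j) ∈ lam ↔ j < ℓ i := by
  have hex : ∀ i, ∃ j, (i, j) ∉ lam := fun i => by
    refine ⟨lam.sup Prod.snd + 1, fun h => ?_⟩
    have := Finset.le_sup (f := Prod.snd) h
    exact absurd this (Nat.not_succ_le_self _)
  have hmem : ∀ i j, (i, j) ∈ lam ↔ j < Nat.find (hex i) := fun i j => by
    rw [Nat.lt_find_iff]
    exact ⟨fun h m hm => not_not.2 (hl.mem_of_le h le_rfl hm), fun h => not_not.1 (h j le_rfl)⟩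
  refine ⟨fun i => Nat.find (hex i), fun i i' hii' => ?_, hmem⟩
  refine Nat.find_min' _ fun h => ?_
  exact Nat.find_spec (hex i) (hl.mem_of_le h hii' le_rfl)

/-- The interval of integers `q, …, q + n - 1`. -/
def intervalList (q : ℤ) (n : ℕ) : List ℤ := (List.range n).map fun k : ℕ => q + k

lemma mem_intervalList {q x : ℤ} {n : ℕ} : x ∈ intervalList q n ↔ q ≤ x ∧ x < q + n := by
  simp only [intervalList, List.mem_map, List.mem_range]
  constructor
  · rintro ⟨k, hk, rfl⟩
    omega
  · rintro ⟨h1, h2⟩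
    exact ⟨(x - q).toNat, by omega, by omega⟩

lemma pairwise_intervalList (q : ℤ) (n : ℕ) : (intervalList q n).Pairwise (· < ·) :=
  List.pairwise_map.2 (List.pairwise_lt_range.imp fun h => by omega)

lemma intervalList_succ (q : ℤ) (n : ℕ) :
    intervalList q (n + 1) = q :: intervalList (q + 1) n := by
  refine (pairwise_intervalList _ _).eq_of_mem_iff ?_ fun x => ?_
  · refine List.pairwise_cons.2 ⟨fun x hx => ?_, pairwise_intervalList _ _⟩
    rw [mem_intervalList] at hx
    omega
  · rw [List.mem_cons, mem_intervalList, mem_intervalList]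
    push_cast
    omega

lemma rowList_minTab {lam : Finset (ℕ × ℕ)} (hl : StraightShape lam) {ℓ : ℕ → ℕ}
    (hℓ : ∀ i j, (i, j) ∈ lam ↔ j < ℓ i) {r c : ℕ} (hb : BoundedBy (minTab lam) r c) (i : ℕ) :
    rowList (minTab lam) c i = intervalList (1 + i) (ℓ i) := by
  refine (pairwise_rowList (increasing_minTab hl) c i).eq_of_mem_iff
    (pairwise_intervalList _ _) fun v => ?_
  rw [mem_rowList hb, mem_intervalList]
  simp only [rowValues, minTab_eq_some_iff hl, hℓ]
  constructor
  · rintro ⟨j, hj, rfl⟩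
    omega
  · rintro ⟨h1, h2⟩
    exact ⟨(v - 1 - i).toNat, by omega, by omega⟩

/-- The effect of the letter `j` on the position `q` of the smallest value. -/
def bump (q j : ℤ) : ℤ := if j = q then q + 1 else q

lemma le_foldl_bump (L : List ℤ) (q : ℤ) : q ≤ L.foldl bump q := by
  induction L generalizing q with
  | nil => exact le_rfl
  | cons x L ih =>
    refine le_trans ?_ (ih _)
    unfold bump
    split_ifs <;> omega

lemma foldl_bump_eq_self_iff {L : List ℤ} {q : ℤ} : L.foldl bump q = q ↔ q ∉ L := by
  induction L generalizing q with
  | nil => simp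
  | cons x L ih =>
    rw [List.foldl_cons, List.mem_cons]
    by_cases h : q = x
    · subst h
      have := le_foldl_bump L (q + 1)
      simp [bump]
      omega
    · rw [bump, if_neg (Ne.symm h), ih]
      simp [h]

lemma foldl_bump_intervalList (q : ℤ) (n : ℕ) : (intervalList q n).foldl bump q = q + n := by
  induction n generalizing q with
  | zero => simp [intervalList]
  | succ n ih =>
    rw [intervalList_succ, List.foldl_cons, bump, if_pos rfl, ih]
    push_cast
    ring

lemma demazureStep_bump {u : Equiv.Perm ℤ} {p q j : ℤ} (hq : u q = p) (hpq : p ≤ q)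
    (hu : ∀ y, p ≤ y → p ≤ u y) (hj : p ≤ j) :
    demazureStep u j (bump q j) = p ∧ p ≤ bump q j ∧ ∀ y, p ≤ y → p ≤ demazureStep u j y := by
  refine ⟨?_, ?_, ?_⟩
  · unfold demazureStep bump
    by_cases h : j = q
    · subst h
      have h1 := hu (j + 1) (by omega)
      have h2 : u (j + 1) ≠ p := fun h => by
        have := u.injective (h.trans hq.symm)
        omega
      rw [if_pos (by omega), if_pos rfl]
      simpa using hq
    · rw [if_neg h]
      split_ifs with h1
      · have h2 : q ≠ j + 1 := by
          rintro rfl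
          have := hu j hj
          omega
        simpa [Equiv.swap_apply_of_ne_of_ne (Ne.symm h) h2] using hq
      · exact hq
  · unfold bump
    split_ifs <;> omega
  · intro y hy
    unfold demazureStep
    split_ifs
    · refine hu _ ?_
      rcases eq_or_ne y j with rfl | h1
      · simp
        omega
      · rcases eq_or_ne y (j + 1) with rfl | h2
        · simpa using hj
        · rwa [Equiv.swap_apply_of_ne_of_ne h1 h2]
    · exact hu y hy

lemma foldl_demazureStep_bump {L : List ℤ} {u : Equiv.Perm ℤ} {p q : ℤ} (hq : u q = p)
    (hpq : p ≤ q) (hu : ∀ y, p ≤ y → p ≤ u y) (hL : ∀ x ∈ L, p ≤ x) :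
    L.foldl demazureStep u (L.foldl bump q) = p ∧
      ∀ y, p ≤ y → p ≤ L.foldl demazureStep u y := by
  induction L generalizing u q with
  | nil => exact ⟨hq, hu⟩
  | cons x L ih =>
    obtain ⟨h1, h2, h3⟩ := demazureStep_bump hq hpq hu (hL x List.mem_cons_self)
    exact ih h1 h2 h3 fun y hy => hL y (List.mem_cons_of_mem _ hy)

lemma foldl_bump_eq_of_foldl_eq {L L' : List ℤ} {p : ℤ} (hL : ∀ x ∈ L, p ≤ x)
    (hL' : ∀ x ∈ L', p ≤ x) (h : L.foldl demazureStep 1 = L'.foldl demazureStep 1) :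
    L.foldl bump p = L'.foldl bump p := by
  have h1 := (foldl_demazureStep_bump (u := 1) (q := p) rfl le_rfl (fun y hy => hy) hL).1
  have h2 := (foldl_demazureStep_bump (u := 1) (q := p) rfl le_rfl (fun y hy => hy) hL').1
  rw [← h, ← h1] at h2
  exact (Equiv.injective _ h2).symm

/-- If the smallest letter of two words with equal Hecke permutations is bounded below, then
either both words contain the bound or neither does. -/
lemma mem_iff_of_foldl_eq {L L' : List ℤ} {p : ℤ} (hL : ∀ x ∈ L, p ≤ x)
    (hL' : ∀ x ∈ L', p ≤ x) (h : L.foldl demazureStep 1 = L'.foldl demazureStep 1) :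
    p ∈ L ↔ p ∈ L' := by
  rw [← not_iff_not, ← foldl_bump_eq_self_iff, ← foldl_bump_eq_self_iff,
    foldl_bump_eq_of_foldl_eq hL hL' h]

lemma exists_le_of_list (L : List ℤ) (hne : L ≠ []) : ∃ m ∈ L, ∀ x ∈ L, m ≤ x := by
  obtain ⟨m, hm, h⟩ := L.toFinset.exists_minimal (by simpa using hne)
  refine ⟨m, by simpa using hm, fun x hx => ?_⟩
  by_contra! hlt
  exact absurd (h (by simpa using hx) hlt.le) (by omega)

lemma eq_nil_of_foldl_eq_one {L : List ℤ} (h : L.foldl demazureStep 1 = 1) : L = [] := by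
  by_contra hne
  obtain ⟨m, hm, hmin⟩ := exists_le_of_list L hne
  have := (mem_iff_of_foldl_eq (L' := []) hmin (by simp) h).1 hm
  simp at this

lemma exists_eq_intervalList_append {n : ℕ} {q : ℤ} {L rest : List ℤ} (hL : L.Pairwise (· < ·))
    (hq : ∀ x ∈ L, q ≤ x) (hrest : ∀ x ∈ rest, q + n ≤ x)
    (h : (L ++ rest).foldl bump q = q + n) :
    ∃ L', L = intervalList q n ++ L' ∧ ∀ x ∈ L' ++ rest, q + n + 1 ≤ x := by
  induction n generalizing q L with
  | zero =>
    refine ⟨L, by simp [intervalList], fun x hx => ?_⟩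
    have h1 : q ∉ L ++ rest := foldl_bump_eq_self_iff.1 (by simpa using h)
    have h2 : x ≠ q := fun hxq => h1 (hxq ▸ hx)
    have h3 : q ≤ x := by
      rcases List.mem_append.1 hx with hx | hx
      · exact hq x hx
      · simpa using hrest x hx
    push_cast
    omega
  | succ n ih =>
    have hqm : q ∈ L ++ rest := by
      by_contra hcon
      rw [foldl_bump_eq_self_iff.2 hcon] at h
      push_cast at h
      omega
    have hqL : q ∈ L := by
      rcases List.mem_append.1 hqm with hx | hx
      · exact hx
      · have := hrest q hx
        push_cast at this
        omega
    rcases L with _ | ⟨x, L⟩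
    · simp at hqL
    · rw [List.pairwise_cons] at hL
      have hxq : x = q := by
        rcases List.mem_cons.1 hqL with hx | hx
        · exact hx.symm
        · have h1 := hL.1 q hx
          have h2 := hq x List.mem_cons_self
          omega
      subst hxq
      rw [List.cons_append, List.foldl_cons, bump, if_pos rfl] at h
      obtain ⟨L', rfl, h'⟩ := ih hL.2 (fun y hy => hL.1 y hy)
        (fun y hy => by have := hrest y hy; push_cast at this; omega)
        (by rw [h]; push_cast; ring)
      refine ⟨L', by rw [intervalList_succ]; rfl, fun y hy => ?_⟩
      have := h' y hy
      push_cast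
      omega

lemma foldl_demazureStep_comm {R S : List ℤ} (h : ∀ x ∈ R, ∀ y ∈ S, x + 2 ≤ y)
    (u : Equiv.Perm ℤ) :
    (R ++ S).foldl demazureStep u = (S ++ R).foldl demazureStep u := by
  have hc : Commute (R.map demazureGen).prod (S.map demazureGen).prod := by
    refine Commute.list_prod_left _ _ fun a ha => Commute.list_prod_right _ _ fun b hb => ?_
    obtain ⟨x, hx, rfl⟩ := List.mem_map.1 ha
    obtain ⟨y, hy, rfl⟩ := List.mem_map.1 hb
    exact isZeroHecke_demazureGen.comm x y (h x hx y hy)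
  rw [← unop_prod_demazureGen, ← unop_prod_demazureGen, List.map_append, List.map_append,
    List.prod_append, List.prod_append, hc.eq]

lemma foldl_demazureStep_intervalList {u : Equiv.Perm ℤ} {p q : ℤ} (hq : u q = p) (hpq : p ≤ q)
    (hu : ∀ y, p ≤ y → p ≤ u y) (n : ℕ) : (intervalList q n).foldl demazureStep u =
      u * ((intervalList q n).map fun j => Equiv.swap j (j + 1)).prod := by
  induction n generalizing u q with
  | zero => simp [intervalList]
  | succ n ih =>
    obtain ⟨h1, h2, h3⟩ := demazureStep_bump hq hpq hu hpq
    rw [bump, if_pos rfl] at h1 h2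
    have hlt : u q < u (q + 1) := by
      have h4 := hu (q + 1) (by omega)
      have h5 : u (q + 1) ≠ u q := fun h => by
        have := u.injective h
        omega
      omega
    rw [intervalList_succ, List.foldl_cons, ih h1 h2 h3, List.map_cons, List.prod_cons,
      ← mul_assoc, demazureStep, if_pos hlt]

lemma foldl_eq_of_append_intervalList {A B : List ℤ} {p : ℤ} {n : ℕ} (hA : ∀ x ∈ A, p + 1 ≤ x)
    (hB : ∀ x ∈ B, p + 1 ≤ x) (h : (A ++ intervalList p n).foldl demazureStep 1 =
      (B ++ intervalList p n).foldl demazureStep 1) :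
    A.foldl demazureStep 1 = B.foldl demazureStep 1 := by
  have key : ∀ C : List ℤ, (∀ x ∈ C, p + 1 ≤ x) → (C ++ intervalList p n).foldl demazureStep 1 =
      C.foldl demazureStep 1 * ((intervalList p n).map fun j => Equiv.swap j (j + 1)).prod := by
    intro C hC
    obtain ⟨h1, h2⟩ := foldl_demazureStep_bump (L := C) (u := 1) (p := p) (q := p) rfl le_rfl
      (fun y hy => hy) (fun x hx => by have := hC x hx; omega)
    rw [foldl_bump_eq_self_iff.2 fun hp => by have := hC p hp; omega] at h1
    rw [List.foldl_append, foldl_demazureStep_intervalList h1 le_rfl h2]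
  rw [key A hA, key B hB] at h
  exact mul_right_cancel h

/-- The concatenation `f (n - 1) ++ ⋯ ++ f 0`. -/
def rowsWord (f : ℕ → List ℤ) (n : ℕ) : List ℤ := (List.range n).reverse.flatMap f

lemma rowsWord_succ (f : ℕ → List ℤ) (n : ℕ) :
    rowsWord f (n + 1) = rowsWord (fun i => f (i + 1)) n ++ f 0 := by
  unfold rowsWord
  rw [List.range_succ_eq_map, List.reverse_cons, List.flatMap_append, ← List.map_reverse,
    List.flatMap_map]
  simp

lemma le_of_mem_rowsWord {f : ℕ → List ℤ} {p : ℤ} (hf : ∀ i, ∀ x ∈ f i, p + i ≤ x) {n : ℕ}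
    {x : ℤ} (hx : x ∈ rowsWord f n) : p ≤ x := by
  obtain ⟨i, -, hi⟩ := List.mem_flatMap.1 hx
  have := hf i x hi
  omega

/-- A row-increasing word with the Hecke permutation of a minimal tableau coincides with the word
of that tableau. -/
theorem eq_intervalList_of_foldl_eq {ℓ : ℕ → ℕ} (hℓ : Antitone ℓ) {f : ℕ → List ℤ} {p : ℤ}
    {rest : List ℤ} (n : ℕ) (hsort : ∀ i, (f i).Pairwise (· < ·))
    (hf : ∀ i, ∀ x ∈ f i, p + i ≤ x) (hrest : ∀ x ∈ rest, p + ℓ 0 ≤ x)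
    (h : (rowsWord f n ++ rest).foldl demazureStep 1 =
      (rowsWord (fun i => intervalList (p + i) (ℓ i)) n).foldl demazureStep 1) :
    (∀ i < n, f i = intervalList (p + i) (ℓ i)) ∧ rest = [] := by
  induction n generalizing ℓ f p rest with
  | zero => exact ⟨fun i hi => absurd hi (Nat.not_lt_zero i), eq_nil_of_foldl_eq_one h⟩
  | succ n ih =>
    have hshift : (fun i : ℕ => intervalList (p + (i + 1 : ℕ)) (ℓ (i + 1))) =
        fun i : ℕ => intervalList (p + 1 + i) (ℓ (i + 1)) := by
      funext i
      congr 1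
      push_cast
      ring
    have hf' : ∀ i : ℕ, ∀ x ∈ f (i + 1), p + 1 + i ≤ x := fun i x hx => by
      have := hf (i + 1) x hx
      push_cast at this
      omega
    have hg' : ∀ i : ℕ, ∀ x ∈ intervalList (p + 1 + i) (ℓ (i + 1)), p + 1 + i ≤ x :=
      fun i x hx => (mem_intervalList.1 hx).1
    rw [rowsWord_succ, rowsWord_succ, hshift] at h
    simp only [Nat.cast_zero, add_zero] at h
    set A := rowsWord (fun i => f (i + 1)) n with hA
    set B := rowsWord (fun i => intervalList (p + 1 + i) (ℓ (i + 1))) n with hB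
    have hA1 : ∀ x ∈ A, p + 1 ≤ x := fun x hx => le_of_mem_rowsWord hf' hx
    have hB1 : ∀ x ∈ B, p + 1 ≤ x := fun x hx => le_of_mem_rowsWord hg' hx
    have hf0 : ∀ x ∈ f 0, p ≤ x := fun x hx => by simpa using hf 0 x hx
    have hpos := foldl_bump_eq_of_foldl_eq (p := p) (fun x hx => by
      simp only [List.mem_append] at hx
      rcases hx with (hx | hx) | hx
      · have := hA1 x hx; omega
      · exact hf0 x hx
      · have := hrest x hx; omega) (fun x hx => by
      rcases List.mem_append.1 hx with hx | hx
      · have := hB1 x hx; omega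
      · exact (mem_intervalList.1 hx).1) h
    have hpA : A.foldl bump p = p := foldl_bump_eq_self_iff.2 fun hp => by
      have := hA1 p hp; omega
    have hpB : B.foldl bump p = p := foldl_bump_eq_self_iff.2 fun hp => by
      have := hB1 p hp; omega
    rw [List.append_assoc, List.foldl_append, hpA, List.foldl_append (l := B), hpB,
      foldl_bump_intervalList] at hpos
    obtain ⟨L', hL', hmem⟩ := exists_eq_intervalList_append (hsort 0) hf0 hrest hpos
    rw [hL', List.append_assoc, List.append_assoc, List.foldl_append,
      foldl_demazureStep_comm (fun x hx y hy => by
        have h1 := (mem_intervalList.1 hx).2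
        have h2 := hmem y hy
        omega), ← List.foldl_append, ← List.append_assoc] at h
    have hcancel := foldl_eq_of_append_intervalList (fun x hx => by
      rcases List.mem_append.1 hx with hx | hx
      · exact hA1 x hx
      · have := hmem x hx; omega) hB1 h
    obtain ⟨h1, h2⟩ := ih (ℓ := fun i => ℓ (i + 1)) (fun i j hij => hℓ (Nat.succ_le_succ hij))
      (fun i => hsort (i + 1)) hf' (fun x hx => by
        have h3 := hmem x hx
        have h4 : ℓ (0 + 1) ≤ ℓ 0 := hℓ (Nat.zero_le _)
        omega) hcancel
    obtain ⟨rfl, rfl⟩ := List.append_eq_nil_iff.1 h2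
    refine ⟨fun i hi => ?_, rfl⟩
    rcases i with _ | i
    · simpa using hL'
    · exact (h1 i (by omega)).trans (congrFun hshift i).symm

lemma HasStraightShape.exists_eq_some_of_le {T : ℕ × ℕ → Option ℤ} (hT : HasStraightShape T)
    {i j i' j' : ℕ} {v : ℤ} (h : T (i, j) = some v) (hi : i' ≤ i) (hj : j' ≤ j) :
    ∃ w, T (i', j') = some w := by
  obtain ⟨lam, hl, hsh⟩ := hT
  have hmem : ∀ p, T p ≠ none ↔ p ∈ lam := fun p => Set.ext_iff.1 hsh p
  refine Option.ne_none_iff_exists'.1 ((hmem _).2 (hl.mem_of_le ((hmem (i, j)).1 ?_) hi hj))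
  simp [h]

lemma HasStraightShape.hasSkewShape {L : Type} [PartialOrder L] {T : L → Option ℤ}
    (hT : HasStraightShape T) : HasSkewShape T := by
  obtain ⟨lam, hl, hsh⟩ := hT
  exact ⟨∅, lam, ⟨by simp [StraightShape], hl, Finset.empty_subset _⟩, by simpa using hsh⟩

lemma add_le_of_increasing {T : ℕ × ℕ → Option ℤ} (hT : HasStraightShape T) (hi : Increasing T)
    {p : ℤ} (hp : ∀ α x, T α = some x → p ≤ x) {i j : ℕ} {v : ℤ} (h : T (i, j) = some v) :
    p + i ≤ v := by
  induction i generalizing v with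
  | zero => simpa using hp _ _ h
  | succ i ih =>
    obtain ⟨w, hw⟩ := hT.exists_eq_some_of_le h (Nat.le_succ i) le_rfl
    have h1 := ih hw
    have h2 := hi _ _ (Prod.mk_lt_mk_iff_left.2 (Nat.lt_succ_self i)) w v hw h
    push_cast
    omega

/-- An increasing tableau of straight shape is determined by the set of values in each row. -/
lemma eq_of_rowValues_iff {T U : ℕ × ℕ → Option ℤ} (hT : HasStraightShape T) (hi : Increasing T)
    (hU : HasStraightShape U) (hi' : Increasing U)
    (h : ∀ i v, rowValues T i v ↔ rowValues U i v) : T = U := by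
  have half : ∀ {T U : ℕ × ℕ → Option ℤ}, Increasing T → HasStraightShape U → Increasing U →
      (∀ i v, rowValues T i v → rowValues U i v) → ∀ {i j : ℕ},
      (∀ k < j, T (i, k) = U (i, k)) → ∀ {v}, T (i, j) = some v →
      ∃ w ≤ v, U (i, j) = some w := by
    intro T U hi hU hi' h i j hj v hv
    obtain ⟨k, hk⟩ := h i v ⟨j, hv⟩
    rcases lt_trichotomy k j with hkj | rfl | hkj
    · have := hi _ _ (Prod.mk_lt_mk_iff_right.2 hkj) v v ((hj k hkj).trans hk) hv
      omega
    · exact ⟨v, le_rfl, hk⟩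
    · obtain ⟨w, hw⟩ := hU.exists_eq_some_of_le hk le_rfl hkj.le
      exact ⟨w, (hi' _ _ (Prod.mk_lt_mk_iff_right.2 hkj) w v hw hk).le, hw⟩
  funext ⟨i, j⟩
  induction j using Nat.strong_induction_on with
  | _ j ih =>
    have h1 := @half T U hi hU hi' (fun i v => (h i v).1) i j ih
    have h2 := @half U T hi' hT hi (fun i v => (h i v).2) i j fun k hk => (ih k hk).symm
    ext v
    constructor
    · intro hv
      obtain ⟨w, hwv, hw⟩ := h1 hv
      obtain ⟨x, hxw, hx⟩ := h2 hw
      have hxv : x = v := Option.some_injective _ (hx.symm.trans hv)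
      rw [hw, show w = v by omega]
    · intro hv
      obtain ⟨w, hwv, hw⟩ := h2 hv
      obtain ⟨x, hxw, hx⟩ := h1 hw
      have hxv : x = v := Option.some_injective _ (hx.symm.trans hv)
      rw [hw, show w = v by omega]

lemma BoundedBy.mono {T : ℕ × ℕ → Option ℤ} {r c r' c' : ℕ} (h : BoundedBy T r c) (hr : r ≤ r')
    (hc : c ≤ c') : BoundedBy T r' c' :=
  fun p hp => ⟨(h p hp).1.trans hr, (h p hp).2.trans hc⟩

lemma mem_rowWord {T : ℕ × ℕ → Option ℤ} {r c : ℕ} (hb : BoundedBy T r c) {v : ℤ} :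
    v ∈ rowWord T r c ↔ ∃ α, T α = some v := by
  have h1 : v ∈ rowWord T r c ↔ ∃ i < r + 1, v ∈ rowList T c i := by
    simp [rowWord, rowList]
  rw [h1]
  simp only [mem_rowList hb]
  constructor
  · rintro ⟨i, -, j, h⟩
    exact ⟨_, h⟩
  · rintro ⟨⟨i, j⟩, h⟩
    exact ⟨i, rowValues_lt hb ⟨j, h⟩, j, h⟩

lemma one_le_of_minTab_eq_some {lam : Finset (ℕ × ℕ)} (hl : StraightShape lam) {α : ℕ × ℕ}
    {v : ℤ} (h : minTab lam α = some v) : 1 ≤ v := by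
  have := ((minTab_eq_some_iff (i := α.1) (j := α.2) hl).1 h).2
  omega

/-- A minimal tableau is the only increasing tableau of straight shape with its Hecke
permutation. -/
theorem eq_minTab_of_heckeWord_eq {lam : Finset (ℕ × ℕ)} (hl : StraightShape lam)
    {T : ℕ × ℕ → Option ℤ} (hT : HasStraightShape T) (hi : Increasing T) {r c : ℕ}
    (hb : BoundedBy T r c) (hb' : BoundedBy (minTab lam) r c)
    (h : heckeWord (rowWord T r c) = heckeWord (rowWord (minTab lam) r c)) : T = minTab lam := by
  obtain ⟨ℓ, hℓ, hmem⟩ := exists_rowLength hl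
  rw [heckeWord_eq, heckeWord_eq] at h
  have hpos : ∀ α x, T α = some x → 1 ≤ x := by
    intro α x hx
    by_contra! hlt
    have hxW := (mem_rowWord hb).2 ⟨α, hx⟩
    obtain ⟨m, hm, hmin⟩ := exists_le_of_list _ (List.ne_nil_of_mem hxW)
    have hmx := hmin x hxW
    have hM : ∀ y ∈ rowWord (minTab lam) r c, 1 ≤ y := fun y hy => by
      obtain ⟨β, hβ⟩ := (mem_rowWord hb').1 hy
      exact one_le_of_minTab_eq_some hl hβ
    have := hM m ((mem_iff_of_foldl_eq hmin (fun y hy => by have := hM y hy; omega) h).1 hm)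
    omega
  have hrows : ∀ i < r + 1, rowList T c i = rowList (minTab lam) c i := by
    have hw : rowWord (minTab lam) r c = rowsWord (fun i => intervalList (1 + i) (ℓ i)) (r + 1) := by
      rw [← funext (rowList_minTab hl hmem hb')]
      rfl
    rw [hw] at h
    simp only [rowList_minTab hl hmem hb']
    refine (eq_intervalList_of_foldl_eq hℓ (f := rowList T c) (rest := []) (r + 1)
      (pairwise_rowList hi c) (fun i x hx => ?_) (by simp) ?_).1
    · obtain ⟨j, hj⟩ := (mem_rowList hb).1 hx
      exact add_le_of_increasing hT hi hpos hj
    · rw [List.append_nil]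
      exact h
  refine eq_of_rowValues_iff hT hi (hasStraightShape_minTab hl) (increasing_minTab hl)
    fun i v => ⟨fun hv => ?_, fun hv => ?_⟩
  · rwa [← mem_rowList hb', ← hrows i (rowValues_lt hb hv), mem_rowList hb]
  · rwa [← mem_rowList hb, hrows i (rowValues_lt hb' hv), mem_rowList hb']

/-- A tableau with the Hecke permutation of a minimal tableau rectifies only to it. -/
lemma eq_minTab_of_rectifiesTo {lam : Finset (ℕ × ℕ)} (hl : StraightShape lam)
    {T U : ℕ × ℕ → Option ℤ} (hT : IncreasingSkewTableau T) (hU : RectifiesTo T U)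
    {r c r' c' : ℕ} (hb : BoundedBy T r c) (hb' : BoundedBy (minTab lam) r' c')
    (h : heckeWord (rowWord T r c) = heckeWord (rowWord (minTab lam) r' c')) :
    U = minTab lam := by
  have hUi := increasingSkewTableau_of_slides hT hU.1
  obtain ⟨s, d, hUb⟩ := exists_boundedBy hUi.1
  have hUb1 := hUb.mono (le_max_left s r') (le_max_left d c')
  have hb1 := hb'.mono (le_max_right s r') (le_max_right d c')
  refine eq_minTab_of_heckeWord_eq hl hU.2 hUi.2 hUb1 hb1 ?_
  rw [← heckeWord_eq_of_slides hT hU.1 hb hUb1, h]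
  exact heckeWord_eq_of_slides ⟨(hasStraightShape_minTab hl).hasSkewShape, increasing_minTab hl⟩
    Relation.ReflTransGen.refl hb' hb1

theorem minimal_tableau_urt_typeA
    (lam : Finset (ℕ × ℕ)) (hl : StraightShape lam)
    (rm cm : ℕ) (hbm : BoundedBy (minTab lam) rm cm) :
    IsURT (minTab lam) ∧
    ∀ T : ℕ × ℕ → Option ℤ, IncreasingSkewTableau T →
      ∀ r c : ℕ, BoundedBy T r c →
        (RectifiesTo T (minTab lam) ↔
          heckeWord (rowWord T r c) = heckeWord (rowWord (minTab lam) rm cm)) := by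
  refine ⟨⟨hasStraightShape_minTab hl, increasing_minTab hl, fun T hT hM U hU => ?_⟩,
    fun T hT r c hb => ⟨fun hM => heckeWord_eq_of_slides hT hM.1 hb hbm, fun h => ?_⟩⟩
  · obtain ⟨r, c, hb⟩ := exists_boundedBy hT.1
    exact eq_minTab_of_rectifiesTo hl hT hU hb hbm (heckeWord_eq_of_slides hT hM.1 hb hbm)
  · obtain ⟨U, hU⟩ := exists_rectifiesTo hT
    rw [← eq_minTab_of_rectifiesTo hl hT hU hb hbm h]
    exact hU
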